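/- arXiv:1910.05854 — 2 statements merged into one kernel-verified Lean document; each statement's English description precedes it below -/
import Mathlib

section
/- For every fixed s > 0, the covariance of the inverse mixed stable subordinator satisfies the refined asymptotic lim_{t→∞} t^{1−α₂} (Cov_Y(s,t) − (s^{2α₁}/C₁²) E²_{α₁−α₂, 2α₁+1}(−C₂ s^{α₁−α₂}/C₁)) = −K(s). -/
open Real MeasureTheory Filter Topology

/-- Two-parameter Mittag-Leffler function `E_{a,b}(x)`. -/
noncomputable def ML (a b x : ℝ) : ℝ :=
  ∑' k : ℕ, x ^ k / Real.Gamma ((k : ℝ) * a + b)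

/-- Second-order (three-parameter, `γ = 2`) Mittag-Leffler function `E²_{a,b}(x)`. -/
noncomputable def ML2 (a b x : ℝ) : ℝ :=
  ∑' k : ℕ, ((k : ℝ) + 1) * x ^ k / Real.Gamma ((k : ℝ) * a + b)

/-- Renewal function `U(t)` of the inverse mixed stable subordinator. -/
noncomputable def Ufun (a1 a2 C1 C2 t : ℝ) : ℝ :=
  t ^ a1 / C1 * ML (a1 - a2) (a1 + 1) (-C2 * t ^ (a1 - a2) / C1)

/-- Renewal density `u(t)` of the inverse mixed stable subordinator. -/
noncomputable def ufun (a1 a2 C1 C2 t : ℝ) : ℝ :=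
  t ^ (a1 - 1) / C1 * ML (a1 - a2) a1 (-C2 * t ^ (a1 - a2) / C1)

/-- Covariance function of the inverse mixed stable subordinator. -/
noncomputable def CovY (a1 a2 C1 C2 s t : ℝ) : ℝ :=
  (∫ τ in (0:ℝ)..(min s t),
      (Ufun a1 a2 C1 C2 (s - τ) + Ufun a1 a2 C1 C2 (t - τ)) * ufun a1 a2 C1 C2 τ)
    - Ufun a1 a2 C1 C2 s * Ufun a1 a2 C1 C2 t

/-- Variance function of the inverse mixed stable subordinator. -/
noncomputable def VarY (a1 a2 C1 C2 t : ℝ) : ℝ := CovY a1 a2 C1 C2 t t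

/-- The integral `I(s,t) = ∫₀^s U(t-τ) u(τ) dτ`. -/
noncomputable def Ifun (a1 a2 C1 C2 s t : ℝ) : ℝ :=
  ∫ τ in (0:ℝ)..s, Ufun a1 a2 C1 C2 (t - τ) * ufun a1 a2 C1 C2 τ

/-- The constant `K(s)`. -/
noncomputable def Kfun (a1 a2 C1 C2 s : ℝ) : ℝ :=
  s ^ (a1 + 1) / (C1 * C2 * Real.Gamma a2) *
    ∑' k : ℕ, ((k : ℝ) * (a1 - a2) + a1) * (-C2 * s ^ (a1 - a2) / C1) ^ k /
      Real.Gamma ((k : ℝ) * (a1 - a2) + a1 + 2)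

/-- Covariance function of the mixed fractional Poisson process. -/
noncomputable def CovN (a1 a2 C1 C2 lam s t : ℝ) : ℝ :=
  lam * Ufun a1 a2 C1 C2 (min s t) + lam ^ 2 * CovY a1 a2 C1 C2 s t

/-- Variance function of the mixed fractional Poisson process. -/
noncomputable def VarN (a1 a2 C1 C2 lam t : ℝ) : ℝ :=
  lam * Ufun a1 a2 C1 C2 t + lam ^ 2 * VarY a1 a2 C1 C2 t

/-- Correlation function of the inverse mixed stable subordinator. -/
noncomputable def CorrY (a1 a2 C1 C2 s t : ℝ) : ℝ :=
  CovY a1 a2 C1 C2 s t /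
    (Real.sqrt (VarY a1 a2 C1 C2 s) * Real.sqrt (VarY a1 a2 C1 C2 t))

/-- Correlation function of the mixed fractional Poisson process. -/
noncomputable def CorrN (a1 a2 C1 C2 lam s t : ℝ) : ℝ :=
  CovN a1 a2 C1 C2 lam s t /
    (Real.sqrt (VarN a1 a2 C1 C2 lam s) * Real.sqrt (VarN a1 a2 C1 C2 lam t))

/-- Covariance function of the mixed fractional Poissonian noise. -/
noncomputable def CovZ (a1 a2 C1 C2 lam δ s t : ℝ) : ℝ :=
  CovN a1 a2 C1 C2 lam (s + δ) (t + δ) + CovN a1 a2 C1 C2 lam s t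
    - CovN a1 a2 C1 C2 lam (s + δ) t - CovN a1 a2 C1 C2 lam s (t + δ)

/-- Variance function of the mixed fractional Poissonian noise. -/
noncomputable def VarZ (a1 a2 C1 C2 lam δ t : ℝ) : ℝ := CovZ a1 a2 C1 C2 lam δ t t

/-- Correlation function of the mixed fractional Poissonian noise. -/
noncomputable def CorrZ (a1 a2 C1 C2 lam δ s t : ℝ) : ℝ :=
  CovZ a1 a2 C1 C2 lam δ s t /
    (Real.sqrt (VarZ a1 a2 C1 C2 lam δ s) * Real.sqrt (VarZ a1 a2 C1 C2 lam δ t))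

/-- Incomplete Beta function `B(a, b; x)`. -/
noncomputable def Binc (a b x : ℝ) : ℝ :=
  ∫ y in (0:ℝ)..x, y ^ (a - 1) * (1 - y) ^ (b - 1)

/-- The closed half-strip `R ≤ re w`, `|im w| ≤ π`. -/
def halfStrip (R : ℝ) : Set ℂ := {w | R ≤ w.re ∧ |w.im| ≤ π}

/-- Integral along the Hankel contour in logarithmic coordinates: the boundary of the half-strip
`halfStrip R`, run from `+∞ - iπ` to `+∞ + iπ`. -/
noncomputable def hankelIntegral (R : ℝ) (G : ℂ → ℂ) : ℂ :=
  (∫ x in Set.Ioi R, (G ((x : ℂ) + (π : ℝ) * Complex.I) - G ((x : ℂ) + (-π : ℝ) * Complex.I)))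
    + Complex.I * ∫ θ in (-π)..π, G ((R : ℂ) + (θ : ℝ) * Complex.I)

/-- The integrand `e^z z^c` written in the coordinate `w = log z`. -/
noncomputable def hankelKernel (c : ℝ) (w : ℂ) : ℂ := Complex.exp (Complex.exp w + c * w)

lemma top_mem_halfStrip {R x : ℝ} (hx : R ≤ x) :
    (x : ℂ) + (π : ℝ) * Complex.I ∈ halfStrip R := by
  simp [halfStrip, hx, abs_of_pos pi_pos]

lemma bottom_mem_halfStrip {R x : ℝ} (hx : R ≤ x) :
    (x : ℂ) + (-π : ℝ) * Complex.I ∈ halfStrip R := by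
  simp [halfStrip, hx, abs_of_pos pi_pos]

lemma side_mem_halfStrip {R θ : ℝ} (hθ : |θ| ≤ π) :
    (R : ℂ) + (θ : ℝ) * Complex.I ∈ halfStrip R := by
  simp [halfStrip, hθ]

lemma differentiable_hankelKernel (c : ℝ) : Differentiable ℂ (hankelKernel c) := by
  unfold hankelKernel
  fun_prop

lemma continuous_hankelKernel (c : ℝ) : Continuous (hankelKernel c) :=
  (differentiable_hankelKernel c).continuous

lemma exp_add_pi (x : ℝ) :
    Complex.exp ((x : ℂ) + (π : ℝ) * Complex.I) = ((-rexp x : ℝ) : ℂ) := by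
  rw [Complex.exp_add, Complex.exp_pi_mul_I]
  simp

lemma exp_add_neg_pi (x : ℝ) :
    Complex.exp ((x : ℂ) + (-π : ℝ) * Complex.I) = ((-rexp x : ℝ) : ℂ) := by
  rw [Complex.exp_add, Complex.ofReal_neg, neg_mul, Complex.exp_neg, Complex.exp_pi_mul_I]
  simp [inv_neg]

lemma norm_hankelKernel_top (c x : ℝ) :
    ‖hankelKernel c ((x : ℂ) + (π : ℝ) * Complex.I)‖ = rexp (-rexp x + c * x) := by
  rw [hankelKernel, exp_add_pi, Complex.norm_exp]
  simp [Complex.exp_ofReal_re]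

lemma norm_hankelKernel_bottom (c x : ℝ) :
    ‖hankelKernel c ((x : ℂ) + (-π : ℝ) * Complex.I)‖ = rexp (-rexp x + c * x) := by
  rw [hankelKernel, exp_add_neg_pi, Complex.norm_exp]
  simp [Complex.exp_ofReal_re]

lemma tendsto_exp_neg_exp_add (c : ℝ) :
    Tendsto (fun x : ℝ => rexp (-rexp x + c * x)) atTop (𝓝 0) := by
  have h := (tendsto_rpow_mul_exp_neg_mul_atTop_nhds_zero c 1 one_pos).comp tendsto_exp_atTop
  refine h.congr fun x => ?_
  simp only [Function.comp]
  rw [← Real.exp_mul, ← Real.exp_add]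
  ring_nf

lemma integrableOn_exp_neg_exp_add (c R : ℝ) :
    IntegrableOn (fun x : ℝ => rexp (-rexp x + c * x)) (Set.Ioi R) := by
  refine integrable_of_isBigO_exp_neg (b := 1) one_pos (by fun_prop) ?_
  have h := (tendsto_exp_neg_exp_add (c + 1)).isBigO_one ℝ
  have h2 := h.mul (Asymptotics.isBigO_refl (fun x : ℝ => rexp (-1 * x)) atTop)
  simp only [one_mul] at h2
  refine h2.congr_left fun x => ?_
  rw [← Real.exp_add]
  ring_nf

lemma integrableOn_of_norm_le_hankelKernel {G : ℂ → ℂ} {R M c : ℝ}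
    (hG : ContinuousOn G (halfStrip R))
    (hb : ∀ w ∈ halfStrip R, ‖G w‖ ≤ M * ‖hankelKernel c w‖) :
    IntegrableOn (fun x : ℝ => G ((x : ℂ) + (π : ℝ) * Complex.I)) (Set.Ioi R) ∧
    IntegrableOn (fun x : ℝ => G ((x : ℂ) + (-π : ℝ) * Complex.I)) (Set.Ioi R) ∧
    IntervalIntegrable (fun θ : ℝ => G ((R : ℂ) + (θ : ℝ) * Complex.I)) volume (-π) π := by
  refine ⟨?_, ?_, ?_⟩
  · refine Integrable.mono' ((integrableOn_exp_neg_exp_add c R).const_mul M) ?_ ?_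
    · refine ContinuousOn.aestronglyMeasurable (hG.comp (by fun_prop) ?_) measurableSet_Ioi
      exact fun x hx => top_mem_halfStrip (le_of_lt hx)
    · refine (ae_restrict_mem measurableSet_Ioi).mono fun x hx => ?_
      rw [← norm_hankelKernel_top]
      exact hb _ (top_mem_halfStrip (le_of_lt hx))
  · refine Integrable.mono' ((integrableOn_exp_neg_exp_add c R).const_mul M) ?_ ?_
    · refine ContinuousOn.aestronglyMeasurable (hG.comp (by fun_prop) ?_) measurableSet_Ioi
      exact fun x hx => bottom_mem_halfStrip (le_of_lt hx)
    · refine (ae_restrict_mem measurableSet_Ioi).mono fun x hx => ?_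
      rw [← norm_hankelKernel_bottom]
      exact hb _ (bottom_mem_halfStrip (le_of_lt hx))
  · refine ContinuousOn.intervalIntegrable (hG.comp (by fun_prop) ?_)
    intro θ hθ
    rw [Set.uIcc_of_le (by linarith [pi_pos])] at hθ
    exact side_mem_halfStrip (abs_le.2 hθ)

lemma integrableOn_hankelKernel (c R : ℝ) :
    IntegrableOn (fun x : ℝ => hankelKernel c ((x : ℂ) + (π : ℝ) * Complex.I)) (Set.Ioi R) ∧
    IntegrableOn (fun x : ℝ => hankelKernel c ((x : ℂ) + (-π : ℝ) * Complex.I)) (Set.Ioi R) ∧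
    IntervalIntegrable (fun θ : ℝ => hankelKernel c ((R : ℂ) + (θ : ℝ) * Complex.I))
      volume (-π) π :=
  integrableOn_of_norm_le_hankelKernel (M := 1) (c := c)
    (continuous_hankelKernel c).continuousOn (by simp)

lemma hankelIntegral_sum (R : ℝ) (n : ℕ) (a : ℕ → ℂ) (c : ℕ → ℝ) :
    hankelIntegral R (fun w => ∑ k ∈ Finset.range n, a k * hankelKernel (c k) w)
      = ∑ k ∈ Finset.range n, a k * hankelIntegral R (hankelKernel (c k)) := by
  have hint (k : ℕ) : IntegrableOn (fun x : ℝ =>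
      a k * (hankelKernel (c k) ((x : ℂ) + (π : ℝ) * Complex.I)
        - hankelKernel (c k) ((x : ℂ) + (-π : ℝ) * Complex.I))) (Set.Ioi R) :=
    ((integrableOn_hankelKernel (c k) R).1.sub (integrableOn_hankelKernel (c k) R).2.1).const_mul _
  unfold hankelIntegral
  rw [intervalIntegral.integral_finsetSum
    fun k _ => (integrableOn_hankelKernel (c k) R).2.2.const_mul (a k)]
  simp_rw [← Finset.sum_sub_distrib, ← mul_sub]
  rw [integral_finsetSum _ fun k _ => hint k, Finset.mul_sum, ← Finset.sum_add_distrib]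
  refine Finset.sum_congr rfl fun k _ => ?_
  rw [integral_const_mul, intervalIntegral.integral_const_mul]
  ring

lemma hankelIntegral_tendsto {ι : Type*} {l : Filter ι} [l.IsCountablyGenerated]
    {F : ι → ℂ → ℂ} {G : ℂ → ℂ} {R : ℝ} (M c : ℝ)
    (hF : ∀ᶠ i in l, ContinuousOn (F i) (halfStrip R))
    (hb : ∀ᶠ i in l, ∀ w ∈ halfStrip R, ‖F i w‖ ≤ M * ‖hankelKernel c w‖)
    (hlim : ∀ w ∈ halfStrip R, Tendsto (fun i => F i w) l (𝓝 (G w))) :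
    Tendsto (fun i => hankelIntegral R (F i)) l (𝓝 (hankelIntegral R G)) := by
  unfold hankelIntegral
  refine Tendsto.add ?_ (Tendsto.const_mul _ ?_)
  · refine tendsto_integral_filter_of_dominated_convergence
      (fun x => M * rexp (-rexp x + c * x) + M * rexp (-rexp x + c * x)) ?_ ?_ ?_ ?_
    · filter_upwards [hF, hb] with i hi hbi
      have h := integrableOn_of_norm_le_hankelKernel hi hbi
      exact (h.1.sub h.2.1).aestronglyMeasurable
    · filter_upwards [hb] with i hbi
      refine (ae_restrict_mem measurableSet_Ioi).mono fun x hx => ?_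
      refine (norm_sub_le _ _).trans (add_le_add ?_ ?_)
      · rw [← norm_hankelKernel_top]
        exact hbi _ (top_mem_halfStrip (le_of_lt hx))
      · rw [← norm_hankelKernel_bottom]
        exact hbi _ (bottom_mem_halfStrip (le_of_lt hx))
    · have h := (integrableOn_exp_neg_exp_add c R).const_mul M
      exact h.add h
    · refine (ae_restrict_mem measurableSet_Ioi).mono fun x hx => ?_
      exact (hlim _ (top_mem_halfStrip (le_of_lt hx))).sub
        (hlim _ (bottom_mem_halfStrip (le_of_lt hx)))
  · have hmem : ∀ θ ∈ Set.uIoc (-π) π, (R : ℂ) + (θ : ℝ) * Complex.I ∈ halfStrip R := by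
      intro θ hθ
      rw [Set.uIoc_of_le (by linarith [pi_pos])] at hθ
      exact side_mem_halfStrip (abs_le.2 ⟨hθ.1.le, hθ.2⟩)
    refine intervalIntegral.tendsto_integral_filter_of_dominated_convergence
      (fun θ : ℝ => M * ‖hankelKernel c ((R : ℂ) + (θ : ℝ) * Complex.I)‖) ?_ ?_ ?_ ?_
    · filter_upwards [hF] with i hi
      exact ContinuousOn.aestronglyMeasurable (hi.comp (by fun_prop) hmem) measurableSet_uIoc
    · filter_upwards [hb] with i hbi
      exact Eventually.of_forall fun θ hθ => hbi _ (hmem θ hθ)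
    · refine Continuous.intervalIntegrable ?_ _ _
      have := continuous_hankelKernel c
      fun_prop
    · exact Eventually.of_forall fun θ hθ => hlim _ (hmem θ hθ)

lemma hankelIntegral_eq_of_le {G : ℂ → ℂ} {L R M c : ℝ} (hLR : L ≤ R)
    (hG : DifferentiableOn ℂ G (halfStrip L))
    (hb : ∀ w ∈ halfStrip L, ‖G w‖ ≤ M * ‖hankelKernel c w‖) :
    hankelIntegral R G = hankelIntegral L G := by
  obtain ⟨h1, h2, -⟩ := integrableOn_of_norm_le_hankelKernel hG.continuousOn hb
  have hC := Complex.integral_boundary_rect_eq_zero_of_differentiableOn G ⟨L, -π⟩ ⟨R, π⟩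
    (hG.mono ?_)
  · have hsub : Set.Ioc L R ⊆ Set.Ioi L := Set.Ioc_subset_Ioi_self
    have hI := intervalIntegral.integral_sub
      ((intervalIntegrable_iff_integrableOn_Ioc_of_le hLR).2 (h1.mono_set hsub))
      ((intervalIntegrable_iff_integrableOn_Ioc_of_le hLR).2 (h2.mono_set hsub))
    have hJ := intervalIntegral.integral_interval_add_Ioi (a := L) (b := R) (h1.sub h2)
      ((h1.sub h2).mono_set (Set.Ioi_subset_Ioi hLR))
    simp only [Pi.sub_apply, smul_eq_mul] at hC hJ
    unfold hankelIntegral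
    rw [← hJ, hI]
    linear_combination hC
  · intro w hw
    rw [Complex.mem_reProdIm, Set.uIcc_of_le hLR, Set.uIcc_of_le (by linarith [pi_pos])] at hw
    exact ⟨hw.1.1, abs_le.2 hw.2⟩

lemma integral_exp_neg_exp_add {c : ℝ} (hc : 0 < c) :
    Integrable (fun x : ℝ => rexp (-rexp x + c * x)) ∧
      ∫ x : ℝ, rexp (-rexp x + c * x) = Real.Gamma c := by
  have hd : ∀ x ∈ Set.univ, HasDerivWithinAt rexp (rexp x) Set.univ x :=
    fun x _ => (Real.hasDerivAt_exp x).hasDerivWithinAt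
  have hinj : Set.InjOn rexp Set.univ := Real.exp_injective.injOn
  have himg : rexp '' Set.univ = Set.Ioi 0 := by rw [Set.image_univ, Real.range_exp]
  have heq : ∀ x : ℝ, |rexp x| • (rexp (-rexp x) * rexp x ^ (c - 1)) = rexp (-rexp x + c * x) := by
    intro x
    rw [abs_of_pos (Real.exp_pos x), ← Real.exp_mul, smul_eq_mul, ← Real.exp_add, ← Real.exp_add]
    ring_nf
  have h1 := integrableOn_image_iff_integrableOn_abs_deriv_smul MeasurableSet.univ hd hinj
    (fun x : ℝ => rexp (-x) * x ^ (c - 1))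
  have h2 := integral_image_eq_integral_abs_deriv_smul MeasurableSet.univ hd hinj
    (fun x : ℝ => rexp (-x) * x ^ (c - 1))
  simp only [heq, himg, integrableOn_univ, setIntegral_univ] at h1 h2
  exact ⟨h1.1 (Real.GammaIntegral_convergent hc), by rw [← h2, Real.Gamma_eq_integral hc]⟩

lemma hankelKernel_top_sub_bottom (c x : ℝ) :
    hankelKernel c ((x : ℂ) + (π : ℝ) * Complex.I)
      - hankelKernel c ((x : ℂ) + (-π : ℝ) * Complex.I)
      = 2 * Complex.I * Real.sin (π * c) * (rexp (-rexp x + c * x) : ℝ) := by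
  have h1 : hankelKernel c ((x : ℂ) + (π : ℝ) * Complex.I)
      = (rexp (-rexp x + c * x) : ℝ) * Complex.exp ((π * c : ℝ) * Complex.I) := by
    rw [hankelKernel, exp_add_pi, Complex.ofReal_exp, ← Complex.exp_add]
    push_cast
    ring_nf
  have h2 : hankelKernel c ((x : ℂ) + (-π : ℝ) * Complex.I)
      = (rexp (-rexp x + c * x) : ℝ) * Complex.exp (((-(π * c) : ℝ) : ℂ) * Complex.I) := by
    rw [hankelKernel, exp_add_neg_pi, Complex.ofReal_exp, ← Complex.exp_add]
    push_cast
    ring_nf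
  rw [h1, h2, Complex.exp_mul_I, Complex.exp_mul_I, ← Complex.ofReal_cos, ← Complex.ofReal_cos,
    ← Complex.ofReal_sin, ← Complex.ofReal_sin, Real.cos_neg, Real.sin_neg]
  push_cast
  ring

lemma tendsto_integral_side_hankelKernel {c : ℝ} (hc : 0 ≤ c) :
    Tendsto (fun L : ℝ => ∫ θ in (-π)..π, hankelKernel c ((L : ℂ) + (θ : ℝ) * Complex.I)) atBot
      (𝓝 (∫ _ in (-π)..π, if c = 0 then 1 else 0)) := by
  refine intervalIntegral.tendsto_integral_filter_of_dominated_convergence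
    (fun _ : ℝ => rexp 1) ?_ ?_ ?_ ?_
  · refine Eventually.of_forall fun L => Continuous.aestronglyMeasurable ?_
    have := continuous_hankelKernel c
    fun_prop
  · filter_upwards [eventually_le_atBot 0] with L hL
    refine Eventually.of_forall fun θ _ => ?_
    rw [hankelKernel, Complex.norm_exp]
    refine Real.exp_le_exp.2 ?_
    have h1 := (Complex.re_le_norm (Complex.exp ((L : ℂ) + (θ : ℝ) * Complex.I)))
    rw [Complex.norm_exp] at h1
    have h2 : rexp L ≤ 1 := Real.exp_le_one_iff.2 hL
    have h3 : c * L ≤ 0 := mul_nonpos_of_nonneg_of_nonpos hc hL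
    simp at h1 ⊢
    linarith
  · exact intervalIntegrable_const
  · refine Eventually.of_forall fun θ _ => ?_
    have h0 : Tendsto (fun L : ℝ => Complex.exp ((L : ℂ) + (θ : ℝ) * Complex.I)) atBot (𝓝 0) := by
      rw [tendsto_zero_iff_norm_tendsto_zero]
      refine Real.tendsto_exp_atBot.congr fun L => ?_
      simp [Complex.norm_exp]
    have h1 := (Complex.continuous_exp.tendsto 0).comp h0
    rw [Complex.exp_zero] at h1
    split_ifs with h
    · refine h1.congr fun L => ?_
      simp [hankelKernel, h]
    · have h2 : Tendsto (fun L : ℝ => Complex.exp (c * ((L : ℂ) + (θ : ℝ) * Complex.I))) atBot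
          (𝓝 0) := by
        rw [tendsto_zero_iff_norm_tendsto_zero]
        refine (Real.tendsto_exp_atBot.comp
          (tendsto_id.const_mul_atBot (lt_of_le_of_ne hc (Ne.symm h)))).congr fun L => ?_
        simp [Complex.norm_exp]
      have h3 := h1.mul h2
      rw [mul_zero] at h3
      refine h3.congr fun L => ?_
      simp [hankelKernel, Complex.exp_add]

lemma hankelIntegral_hankelKernel_of_le_one {γ : ℝ} (hγ : 0 < γ) (hγ1 : γ ≤ 1) (R : ℝ) :
    hankelIntegral R (hankelKernel (1 - γ)) = 2 * π * Complex.I / (Real.Gamma γ : ℝ) := by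
  have hconst : ∀ᶠ L in atBot,
      hankelIntegral L (hankelKernel (1 - γ)) = hankelIntegral R (hankelKernel (1 - γ)) := by
    filter_upwards [eventually_le_atBot R] with L hL
    exact (hankelIntegral_eq_of_le (M := 1) (c := 1 - γ) hL
      (differentiable_hankelKernel _).differentiableOn (by simp)).symm
  have hside := (tendsto_integral_side_hankelKernel (sub_nonneg.2 hγ1)).const_mul Complex.I
  refine tendsto_nhds_unique (f := fun L => hankelIntegral L (hankelKernel (1 - γ)))
    (tendsto_const_nhds.congr' (hconst.mono fun _ h => h.symm)) ?_
  unfold hankelIntegral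
  simp_rw [hankelKernel_top_sub_bottom, integral_const_mul]
  rcases hγ1.eq_or_lt with rfl | hlt
  · simp only [sub_self, if_true] at hside ⊢
    simp only [mul_zero, Real.sin_zero, Complex.ofReal_zero, zero_mul, zero_add]
    convert hside using 2
    simp
    ring
  · have hc : 0 < 1 - γ := by linarith
    obtain ⟨hi, hv⟩ := integral_exp_neg_exp_add hc
    have h1 := (aecover_Ioi (μ := volume)
      (tendsto_id (α := ℝ) (x := atBot))).integral_tendsto_of_countably_generated hi
    rw [hv] at h1
    have h2 := ((Complex.continuous_ofReal.tendsto _).comp h1).const_mul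
      (2 * Complex.I * (Real.sin (π * (1 - γ)) : ℝ))
    have h3 := h2.add hside
    simp only [Function.comp_def, id, ← integral_complex_ofReal, hc.ne', if_false] at h3
    convert h3 using 2
    have h4 : Real.sin (π * (1 - γ)) * Real.Gamma (1 - γ) = π / Real.Gamma γ := by
      have hs : 0 < Real.sin (π * γ) := Real.sin_pos_of_pos_of_lt_pi (by positivity)
        (by nlinarith [pi_pos])
      have hG := Real.Gamma_pos_of_pos hγ
      have := Real.Gamma_mul_Gamma_one_sub γ
      rw [show π * (1 - γ) = π - π * γ by ring, Real.sin_pi_sub]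
      rw [eq_div_iff hs.ne'] at this
      rw [eq_div_iff hG.ne']
      linear_combination this
    have h5 : (Real.sin (π * (1 - γ)) : ℂ) * (Real.Gamma (1 - γ) : ℝ)
        = (π : ℂ) / (Real.Gamma γ : ℝ) := by exact_mod_cast h4
    simp only [intervalIntegral.integral_zero, mul_zero, add_zero]
    linear_combination (-2 * Complex.I) * h5

lemma hankelIntegral_hankelKernel_recurrence (β R : ℝ) :
    hankelIntegral R (hankelKernel (1 - β)) = β * hankelIntegral R (hankelKernel (-β)) := by
  have hd (w : ℂ) : HasDerivAt (hankelKernel (-β))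
      (hankelKernel (1 - β) w - β * hankelKernel (-β) w) w := by
    have h := ((Complex.hasDerivAt_exp w).add ((hasDerivAt_id w).const_mul ((-β : ℝ) : ℂ))).cexp
    refine h.congr_deriv ?_
    have : hankelKernel (1 - β) w = hankelKernel (-β) w * Complex.exp w := by
      simp only [hankelKernel, ← Complex.exp_add]
      push_cast
      ring_nf
    rw [this]
    simp [hankelKernel]
    ring
  obtain ⟨a1, a2, a3⟩ := integrableOn_hankelKernel (1 - β) R
  obtain ⟨b1, b2, b3⟩ := integrableOn_hankelKernel (-β) R
  have htop := integral_Ioi_of_hasDerivAt_of_tendsto (a := R) (m := 0)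
    (f := fun x : ℝ => hankelKernel (-β) ((x : ℂ) + (π : ℝ) * Complex.I))
    (f' := fun x : ℝ => hankelKernel (1 - β) ((x : ℂ) + (π : ℝ) * Complex.I)
      - β * hankelKernel (-β) ((x : ℂ) + (π : ℝ) * Complex.I))
    (by have := continuous_hankelKernel (-β); fun_prop)
    (fun x _ => ((hd _).comp_add_const (x : ℂ) _).comp_ofReal)
    (a1.sub (b1.const_mul _))
    (by
      rw [tendsto_zero_iff_norm_tendsto_zero]
      simp_rw [norm_hankelKernel_top]
      exact tendsto_exp_neg_exp_add _)
  have hbot := integral_Ioi_of_hasDerivAt_of_tendsto (a := R) (m := 0)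
    (f := fun x : ℝ => hankelKernel (-β) ((x : ℂ) + (-π : ℝ) * Complex.I))
    (f' := fun x : ℝ => hankelKernel (1 - β) ((x : ℂ) + (-π : ℝ) * Complex.I)
      - β * hankelKernel (-β) ((x : ℂ) + (-π : ℝ) * Complex.I))
    (by have := continuous_hankelKernel (-β); fun_prop)
    (fun x _ => ((hd _).comp_add_const (x : ℂ) _).comp_ofReal)
    (a2.sub (b2.const_mul _))
    (by
      rw [tendsto_zero_iff_norm_tendsto_zero]
      simp_rw [norm_hankelKernel_bottom]
      exact tendsto_exp_neg_exp_add _)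
  have hside := intervalIntegral.integral_eq_sub_of_hasDerivAt (a := -π) (b := π)
    (f := fun θ : ℝ => hankelKernel (-β) ((R : ℂ) + (θ : ℝ) * Complex.I))
    (f' := fun θ : ℝ => (hankelKernel (1 - β) ((R : ℂ) + (θ : ℝ) * Complex.I)
      - β * hankelKernel (-β) ((R : ℂ) + (θ : ℝ) * Complex.I)) * Complex.I)
    (fun θ _ => by
      have hw : HasDerivAt (fun z : ℂ => (R : ℂ) + z * Complex.I) Complex.I (θ : ℂ) := by
        simpa using ((hasDerivAt_id (θ : ℂ)).mul_const Complex.I).const_add (R : ℂ)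
      exact ((hd _).comp (θ : ℂ) hw).comp_ofReal)
    ((a3.sub (b3.const_mul _)).mul_const _)
  rw [integral_sub a1 (b1.const_mul _), integral_const_mul] at htop
  rw [integral_sub a2 (b2.const_mul _), integral_const_mul] at hbot
  rw [intervalIntegral.integral_mul_const, intervalIntegral.integral_sub a3 (b3.const_mul _),
    intervalIntegral.integral_const_mul] at hside
  unfold hankelIntegral
  rw [integral_sub a1 a2, integral_sub b1 b2]
  linear_combination htop - hbot + hside

/-- Hankel's formula for the reciprocal of the Gamma function. -/
lemma hankelIntegral_hankelKernel {γ : ℝ} (hγ : 0 < γ) (R : ℝ) :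
    hankelIntegral R (hankelKernel (1 - γ)) = 2 * π * Complex.I / (Real.Gamma γ : ℝ) := by
  obtain ⟨n, hn⟩ := exists_nat_ge γ
  induction n generalizing γ with
  | zero => exact absurd hn (by simpa using hγ)
  | succ n ih =>
    rcases le_or_gt γ 1 with h | h
    · exact hankelIntegral_hankelKernel_of_le_one hγ h R
    · have hγ' : 0 < γ - 1 := by linarith
      have h1 := ih hγ' (by push_cast at hn; linarith)
      have h2 := hankelIntegral_hankelKernel_recurrence (γ - 1) R
      have h3 := Real.Gamma_add_one hγ'.ne'
      rw [sub_add_cancel] at h3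
      rw [h1, show -(γ - 1) = 1 - γ by ring] at h2
      have hne : ((γ - 1 : ℝ) : ℂ) ≠ 0 := by exact_mod_cast hγ'.ne'
      have hG : (Real.Gamma (γ - 1) : ℂ) ≠ 0 := by
        exact_mod_cast (Real.Gamma_pos_of_pos hγ').ne'
      rw [h3, Complex.ofReal_mul]
      field_simp
      field_simp at h2
      linear_combination -h2

lemma exp_mul_rpow_le_Gamma {A y : ℝ} (hA : 0 < A) (hy : 0 < y) :
    rexp (-(A + 1)) * (A ^ y / (A + 1)) ≤ Real.Gamma y := by
  have hint := Real.GammaIntegral_convergent hy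
  have hsub : Set.Ioc A (A + 1) ⊆ Set.Ioi 0 := fun x hx => hA.trans hx.1
  rw [Real.Gamma_eq_integral hy]
  calc rexp (-(A + 1)) * (A ^ y / (A + 1))
      = ∫ _ in Set.Ioc A (A + 1), rexp (-(A + 1)) * (A ^ y / (A + 1)) := by simp
    _ ≤ ∫ x in Set.Ioc A (A + 1), rexp (-x) * x ^ (y - 1) := by
        refine setIntegral_mono_on (integrableOn_const (by simp)) (hint.mono_set hsub)
          measurableSet_Ioc ?_
        intro x hx
        have hx0 : 0 < x := hA.trans hx.1
        rw [Real.rpow_sub_one hx0.ne']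
        have h1 : A ^ y ≤ x ^ y := Real.rpow_le_rpow hA.le hx.1.le hy.le
        have h2 := hx.2
        gcongr
    _ ≤ ∫ x in Set.Ioi 0, rexp (-x) * x ^ (y - 1) := by
        refine setIntegral_mono_set hint ?_ hsub.eventuallyLE
        refine (ae_restrict_mem measurableSet_Ioi).mono fun x hx => ?_
        have hx : 0 < x := hx
        simp only [Pi.zero_apply]
        positivity

lemma summable_ML2 {a b : ℝ} (ha : 0 < a) (hb : 0 < b) (x : ℝ) :
    Summable fun k : ℕ => ((k : ℝ) + 1) * x ^ k / Real.Gamma ((k : ℝ) * a + b) := by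
  set A : ℝ := (4 * |x| + 1) ^ a⁻¹ with hA
  have hA0 : 0 < A := by positivity
  have hAa : A ^ a = 4 * |x| + 1 := by
    rw [hA, ← Real.rpow_mul (by positivity), inv_mul_cancel₀ ha.ne', Real.rpow_one]
  set D : ℝ := rexp (-(A + 1)) * (A ^ b / (A + 1)) with hD
  have hD0 : 0 < D := by positivity
  refine Summable.of_norm_bounded (g := fun k : ℕ => (1 / 2 : ℝ) ^ k * D⁻¹)
    ((summable_geometric_of_lt_one (by norm_num) (by norm_num)).mul_right _) fun k => ?_
  have hy : 0 < (k : ℝ) * a + b := by positivity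
  have hG := Real.Gamma_pos_of_pos hy
  have h1 : D * (4 * |x| + 1) ^ k ≤ Real.Gamma ((k : ℝ) * a + b) := by
    refine le_trans (le_of_eq ?_) (exp_mul_rpow_le_Gamma hA0 hy)
    rw [Real.rpow_add hA0, mul_comm (k : ℝ) a, Real.rpow_mul hA0.le, hAa, Real.rpow_natCast]
    ring
  have h2 : (k : ℝ) + 1 ≤ 2 ^ k := by exact_mod_cast Nat.lt_two_pow_self
  have hk : |(k : ℝ) + 1| = k + 1 := abs_of_pos (by positivity)
  rw [norm_div, norm_mul, norm_pow, Real.norm_eq_abs, Real.norm_eq_abs, Real.norm_eq_abs,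
    abs_of_pos hG, hk, div_le_iff₀ hG]
  calc ((k : ℝ) + 1) * |x| ^ k ≤ 2 ^ k * |x| ^ k := by gcongr
    _ = (1 / 2 : ℝ) ^ k * (4 * |x|) ^ k := by rw [← mul_pow, ← mul_pow]; ring_nf
    _ ≤ (1 / 2 : ℝ) ^ k * (4 * |x| + 1) ^ k := by gcongr; linarith
    _ = (1 / 2 : ℝ) ^ k * D⁻¹ * (D * (4 * |x| + 1) ^ k) := by field_simp
    _ ≤ _ := by gcongr

lemma summable_ML {a b : ℝ} (ha : 0 < a) (hb : 0 < b) (x : ℝ) :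
    Summable fun k : ℕ => x ^ k / Real.Gamma ((k : ℝ) * a + b) := by
  refine (summable_ML2 ha hb x).norm.of_norm_bounded fun k => ?_
  rw [mul_div_assoc, norm_mul]
  refine le_mul_of_one_le_left (norm_nonneg _) ?_
  rw [Real.norm_eq_abs, abs_of_pos (by positivity)]
  linarith [(Nat.cast_nonneg k : (0 : ℝ) ≤ k)]

lemma continuous_ML {a b : ℝ} (ha : 0 < a) (hb : 0 < b) : Continuous (ML a b) := by
  rw [continuous_iff_continuousAt]
  intro x
  have hc : ContinuousOn (ML a b) (Set.Icc (x - 1) (x + 1)) := by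
    unfold ML
    refine continuousOn_tsum (u := fun k : ℕ => (|x| + 1) ^ k / Real.Gamma ((k : ℝ) * a + b))
      (fun k => by fun_prop) (summable_ML ha hb _) fun k y hy => ?_
    have hG := Real.Gamma_pos_of_pos (show 0 < (k : ℝ) * a + b by positivity)
    rw [norm_div, norm_pow, Real.norm_eq_abs, Real.norm_eq_abs, abs_of_pos hG]
    have : |y| ≤ |x| + 1 := by
      rw [abs_le]
      constructor <;> linarith [hy.1, hy.2, neg_abs_le x, le_abs_self x]
    gcongr
  exact hc.continuousAt (Icc_mem_nhds (by linarith) (by linarith))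

lemma mul_sin_le_norm_exp_add {ρ x : ℝ} (hρ : 0 < ρ) (hρ1 : ρ < 1) (hx : 0 < x) {w : ℂ}
    (hw : |w.im| ≤ π) : x * Real.sin (ρ * π) ≤ ‖Complex.exp (ρ * w) + x‖ := by
  have hcos : Real.cos (ρ * π) ≤ Real.cos (ρ * w.im) := by
    rw [← Real.cos_abs (ρ * w.im), abs_mul, abs_of_pos hρ]
    refine Real.cos_le_cos_of_nonneg_of_le_pi (by positivity) (by nlinarith [pi_pos]) ?_
    gcongr
  have hsin : 0 ≤ Real.sin (ρ * π) :=
    Real.sin_nonneg_of_nonneg_of_le_pi (by positivity) (by nlinarith [pi_pos])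
  rw [← abs_of_nonneg (mul_nonneg hx.le hsin), ← abs_of_nonneg (norm_nonneg _), ← sq_le_sq,
    Complex.sq_norm, Complex.normSq_apply]
  have hre : (Complex.exp (ρ * w)).re = rexp (ρ * w.re) * Real.cos (ρ * w.im) := by
    simp [Complex.exp_re]
  have him : (Complex.exp (ρ * w)).im = rexp (ρ * w.re) * Real.sin (ρ * w.im) := by
    simp [Complex.exp_im]
  simp only [Complex.add_re, Complex.add_im, Complex.ofReal_re, Complex.ofReal_im, hre, him]
  set r := rexp (ρ * w.re)
  have hr : 0 < r := Real.exp_pos _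
  have h1 := Real.sin_sq_add_cos_sq (ρ * w.im)
  have h2 := Real.sin_sq_add_cos_sq (ρ * π)
  have h3 : 0 ≤ r * x * (Real.cos (ρ * w.im) - Real.cos (ρ * π)) :=
    mul_nonneg (by positivity) (by linarith)
  have h4 := sq_nonneg (r + x * Real.cos (ρ * π))
  have h5 : x ^ 2 * Real.sin (ρ * π) ^ 2 = x ^ 2 - x ^ 2 * Real.cos (ρ * π) ^ 2 := by
    linear_combination x ^ 2 * h2
  have h6 : r ^ 2 * Real.sin (ρ * w.im) ^ 2 = r ^ 2 - r ^ 2 * Real.cos (ρ * w.im) ^ 2 := by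
    linear_combination r ^ 2 * h1
  nlinarith

/-- The Hankel integrand of the two-parameter Mittag-Leffler function `E_{ρ,β}(-x)`. -/
noncomputable def mlKernel (ρ β x : ℝ) (w : ℂ) : ℂ :=
  hankelKernel (1 - (β - ρ)) w / (Complex.exp (ρ * w) + x)

lemma exp_add_ne_zero {ρ x : ℝ} (hρ : 0 < ρ) (hρ1 : ρ < 1) (hx : 0 < x) {w : ℂ}
    (hw : |w.im| ≤ π) : Complex.exp (ρ * w) + x ≠ 0 := by
  have hsin : 0 < Real.sin (ρ * π) :=
    Real.sin_pos_of_pos_of_lt_pi (by positivity) (by nlinarith [pi_pos])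
  exact norm_pos_iff.1 ((mul_pos hx hsin).trans_le (mul_sin_le_norm_exp_add hρ hρ1 hx hw))

lemma differentiableOn_mlKernel {ρ β x : ℝ} (hρ : 0 < ρ) (hρ1 : ρ < 1) (hx : 0 < x) (R : ℝ) :
    DifferentiableOn ℂ (mlKernel ρ β x) (halfStrip R) := by
  refine DifferentiableOn.div (differentiable_hankelKernel _).differentiableOn (by fun_prop) ?_
  exact fun w hw => exp_add_ne_zero hρ hρ1 hx hw.2

lemma norm_mlKernel_le {ρ β x : ℝ} (hρ : 0 < ρ) (hρ1 : ρ < 1) (hx : 0 < x) {w : ℂ}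
    (hw : |w.im| ≤ π) :
    x * ‖mlKernel ρ β x w‖ ≤ (Real.sin (ρ * π))⁻¹ * ‖hankelKernel (1 - (β - ρ)) w‖ := by
  have hsin : 0 < Real.sin (ρ * π) :=
    Real.sin_pos_of_pos_of_lt_pi (by positivity) (by nlinarith [pi_pos])
  have h := mul_sin_le_norm_exp_add hρ hρ1 hx hw
  have hpos : 0 < ‖Complex.exp (ρ * w) + x‖ := norm_pos_iff.2 (exp_add_ne_zero hρ hρ1 hx hw)
  rw [mlKernel, norm_div, mul_div_assoc', div_le_iff₀ hpos]
  calc x * ‖hankelKernel (1 - (β - ρ)) w‖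
      = (Real.sin (ρ * π))⁻¹ * ‖hankelKernel (1 - (β - ρ)) w‖ * (x * Real.sin (ρ * π)) := by
        field_simp
    _ ≤ _ := by gcongr

lemma ML_eq_hankelIntegral_of_large {ρ β x R : ℝ} (hρ : 0 < ρ) (hβ : 0 < β)
    (hx : 0 < x) (hR : 2 * x ≤ rexp (ρ * R)) :
    2 * π * Complex.I * (ML ρ β (-x) : ℝ) = hankelIntegral R (mlKernel ρ β x) := by
  have hq (w : ℂ) (hw : w ∈ halfStrip R) : ‖-x * Complex.exp (-ρ * w)‖ ≤ 1 / 2 := by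
    have h1 : 2 * x ≤ rexp (ρ * w.re) := hR.trans (Real.exp_le_exp.2 (by gcongr; exact hw.1))
    rw [norm_mul, Complex.norm_exp, norm_neg, Complex.norm_real, Real.norm_eq_abs, abs_of_pos hx]
    simp only [neg_mul, Complex.neg_re, Complex.re_ofReal_mul, Real.exp_neg]
    rw [← div_eq_mul_inv, div_le_iff₀ (Real.exp_pos _)]
    linarith
  have hker (k : ℕ) (w : ℂ) : ((-x : ℝ) : ℂ) ^ k * hankelKernel (1 - ((k : ℝ) * ρ + β)) w
      = hankelKernel (1 - β) w * (-x * Complex.exp (-ρ * w)) ^ k := by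
    rw [mul_pow, ← Complex.exp_nat_mul, hankelKernel, hankelKernel, Complex.ofReal_neg]
    rw [mul_left_comm, ← Complex.exp_add]
    push_cast
    ring_nf
  have hsum : Tendsto (fun n : ℕ => ∑ k ∈ Finset.range n, ((-x : ℝ) : ℂ) ^ k *
      hankelIntegral R (hankelKernel (1 - ((k : ℝ) * ρ + β)))) atTop
      (𝓝 (2 * π * Complex.I * (ML ρ β (-x) : ℝ))) := by
    have h := ((Complex.continuous_ofReal.tendsto _).comp
      (summable_ML hρ hβ (-x)).hasSum.tendsto_sum_nat).const_mul (2 * π * Complex.I)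
    refine h.congr fun n => ?_
    simp only [Function.comp, Complex.ofReal_sum, Finset.mul_sum]
    refine Finset.sum_congr rfl fun k _ => ?_
    rw [hankelIntegral_hankelKernel (by positivity)]
    push_cast
    ring
  refine tendsto_nhds_unique hsum ?_
  simp_rw [← hankelIntegral_sum R _ (fun k => ((-x : ℝ) : ℂ) ^ k)
    (fun k => 1 - ((k : ℝ) * ρ + β)), hker, ← Finset.mul_sum]
  refine hankelIntegral_tendsto 2 (1 - β) (Eventually.of_forall fun n => ?_)
    (Eventually.of_forall fun n w hw => ?_) fun w hw => ?_
  · have := continuous_hankelKernel (1 - β)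
    fun_prop
  · rw [norm_mul, mul_comm]
    gcongr
    calc ‖∑ k ∈ Finset.range n, (-x * Complex.exp (-ρ * w)) ^ k‖
        ≤ ∑ k ∈ Finset.range n, (1 / 2 : ℝ) ^ k := by
          refine norm_sum_le_of_le _ fun k _ => ?_
          rw [norm_pow]
          exact pow_le_pow_left₀ (norm_nonneg _) (hq w hw) k
      _ ≤ ∑' k : ℕ, (1 / 2 : ℝ) ^ k :=
          Summable.sum_le_tsum _ (fun _ _ => by positivity) summable_geometric_two
      _ = 2 := tsum_geometric_two
  · have hlt := (hq w hw).trans_lt (by norm_num : (1 / 2 : ℝ) < 1)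
    have h := (hasSum_geometric_of_norm_lt_one hlt).tendsto_sum_nat.const_mul
      (hankelKernel (1 - β) w)
    convert h using 2
    have h1 : hankelKernel (1 - (β - ρ)) w = hankelKernel (1 - β) w * Complex.exp (ρ * w) := by
      rw [hankelKernel, hankelKernel, ← Complex.exp_add]
      push_cast
      ring_nf
    have h2 : Complex.exp (ρ * w) + x
        = Complex.exp (ρ * w) * (1 - -x * Complex.exp (-ρ * w)) := by
      have : Complex.exp (ρ * w) * Complex.exp (-ρ * w) = 1 := by
        rw [← Complex.exp_add]
        simp
      linear_combination (-x : ℂ) * this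
    rw [mlKernel, h1, h2, mul_comm (hankelKernel (1 - β) w), mul_div_mul_left _ _
      (Complex.exp_ne_zero _), div_eq_mul_inv]

lemma ML_eq_hankelIntegral {ρ β x : ℝ} (hρ : 0 < ρ) (hρ1 : ρ < 1) (hβ : 0 < β) (hx : 0 < x) :
    2 * π * Complex.I * (ML ρ β (-x) : ℝ) = hankelIntegral 0 (mlKernel ρ β x) := by
  have htend : Tendsto (fun R => rexp (ρ * R)) atTop atTop :=
    Real.tendsto_exp_atTop.comp (tendsto_id.const_mul_atTop hρ)
  obtain ⟨R, hR, hR0⟩ := ((htend.eventually_ge_atTop (2 * x)).and (eventually_ge_atTop 0)).exists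
  rw [ML_eq_hankelIntegral_of_large hρ hβ hx hR]
  refine hankelIntegral_eq_of_le (M := x⁻¹ * (Real.sin (ρ * π))⁻¹) (c := 1 - (β - ρ)) hR0
    (differentiableOn_mlKernel hρ hρ1 hx 0) fun w hw => ?_
  rw [mul_assoc, ← div_eq_inv_mul, le_div_iff₀' hx]
  exact norm_mlKernel_le hρ hρ1 hx hw.2

/-- Leading asymptotics of the Mittag-Leffler function on the negative half-line. -/
lemma tendsto_mul_ML_neg {ρ β : ℝ} (hρ : 0 < ρ) (hρ1 : ρ < 1) (hβ : ρ < β) :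
    Tendsto (fun x : ℝ => x * ML ρ β (-x)) atTop (𝓝 (Real.Gamma (β - ρ))⁻¹) := by
  have h : Tendsto (fun x : ℝ => hankelIntegral 0 (fun w => (x : ℂ) * mlKernel ρ β x w)) atTop
      (𝓝 (hankelIntegral 0 (hankelKernel (1 - (β - ρ))))) := by
    refine hankelIntegral_tendsto (Real.sin (ρ * π))⁻¹ (1 - (β - ρ)) ?_ ?_ fun w hw => ?_
    · filter_upwards [eventually_gt_atTop 0] with x hx
      exact continuousOn_const.mul (differentiableOn_mlKernel hρ hρ1 hx 0).continuousOn
    · filter_upwards [eventually_gt_atTop 0] with x hx w hw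
      rw [norm_mul, Complex.norm_real, Real.norm_eq_abs, abs_of_pos hx]
      exact norm_mlKernel_le hρ hρ1 hx hw.2
    · have hinv : Tendsto (fun x : ℝ => ((x⁻¹ : ℝ) : ℂ)) atTop (𝓝 0) := by
        have := (Complex.continuous_ofReal.tendsto 0).comp (tendsto_inv_atTop_zero (𝕜 := ℝ))
        rw [Complex.ofReal_zero] at this
        exact this
      have hden := (hinv.const_mul (Complex.exp (ρ * w))).add_const 1
      rw [mul_zero, zero_add] at hden
      have h1 := (tendsto_const_nhds (x := hankelKernel (1 - (β - ρ)) w)).div hden one_ne_zero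
      rw [div_one] at h1
      refine h1.congr' ?_
      filter_upwards [eventually_gt_atTop 0] with x hx
      have hxc : (x : ℂ) ≠ 0 := by exact_mod_cast hx.ne'
      have h2 : Complex.exp (ρ * w) * ((x⁻¹ : ℝ) : ℂ) + 1
          = (Complex.exp (ρ * w) + x) / x := by
        push_cast
        field_simp
      simp only [Pi.div_apply]
      rw [h2, mlKernel, div_div_eq_mul_div]
      ring
  have hpi : (2 * π * Complex.I : ℂ) ≠ 0 := Complex.two_pi_I_ne_zero
  rw [hankelIntegral_hankelKernel (by linarith)] at h
  have h2 := (Complex.continuous_re.tendsto _).comp (h.const_mul (2 * π * Complex.I)⁻¹)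
  rw [div_eq_mul_inv, inv_mul_cancel_left₀ hpi, ← Complex.ofReal_inv, Complex.ofReal_re] at h2
  refine h2.congr' ?_
  filter_upwards [eventually_gt_atTop 0] with x hx
  have h3 : hankelIntegral 0 (fun w => (x : ℂ) * mlKernel ρ β x w)
      = x * hankelIntegral 0 (mlKernel ρ β x) := by
    unfold hankelIntegral
    simp_rw [← mul_sub]
    rw [integral_const_mul, intervalIntegral.integral_const_mul]
    ring
  simp only [Function.comp]
  rw [h3, ← ML_eq_hankelIntegral hρ hρ1 (hρ.trans hβ) hx, mul_left_comm, inv_mul_cancel_left₀ hpi,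
    ← Complex.ofReal_mul, Complex.ofReal_re]

lemma integral_sub_rpow_mul_rpow {p q s : ℝ} (hp : 0 < p) (hq : 0 < q) (hs : 0 < s) :
    IntervalIntegrable (fun τ : ℝ => (s - τ) ^ (p - 1) * τ ^ (q - 1)) volume 0 s ∧
    ∫ τ in (0 : ℝ)..s, (s - τ) ^ (p - 1) * τ ^ (q - 1)
      = Real.Gamma p * Real.Gamma q / Real.Gamma (p + q) * s ^ (p + q - 1) := by
  have hcast : ∀ τ ∈ Set.uIcc 0 s, (τ : ℂ) ^ ((q : ℂ) - 1) * ((s : ℂ) - τ) ^ ((p : ℂ) - 1)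
      = (((s - τ) ^ (p - 1) * τ ^ (q - 1) : ℝ) : ℂ) := by
    intro τ hτ
    rw [Set.uIcc_of_le hs.le] at hτ
    rw [Complex.ofReal_mul, Complex.ofReal_cpow hτ.1, Complex.ofReal_cpow (sub_nonneg.2 hτ.2)]
    push_cast
    ring
  have hval : ∫ τ in (0 : ℝ)..s, (s - τ) ^ (p - 1) * τ ^ (q - 1)
      = Real.Gamma p * Real.Gamma q / Real.Gamma (p + q) * s ^ (p + q - 1) := by
    have h := Complex.betaIntegral_scaled (q : ℂ) (p : ℂ) hs
    rw [intervalIntegral.integral_congr hcast, intervalIntegral.integral_ofReal,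
      Complex.betaIntegral_eq_Gamma_mul_div _ _ (by simpa) (by simpa), ← Complex.ofReal_add,
      Complex.Gamma_ofReal, Complex.Gamma_ofReal, Complex.Gamma_ofReal,
      show (((q + p : ℝ) : ℂ) - 1) = ((q + p - 1 : ℝ) : ℂ) by push_cast; ring,
      ← Complex.ofReal_cpow hs.le] at h
    have h2 : ∫ τ in (0 : ℝ)..s, (s - τ) ^ (p - 1) * τ ^ (q - 1)
        = s ^ (q + p - 1) * (Real.Gamma q * Real.Gamma p / Real.Gamma (q + p)) := by
      exact_mod_cast h
    rw [h2, add_comm q p]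
    ring
  refine ⟨?_, hval⟩
  refine intervalIntegral.intervalIntegrable_of_integral_ne_zero ?_
  rw [hval]
  have := Real.Gamma_pos_of_pos hp
  have := Real.Gamma_pos_of_pos hq
  have := Real.Gamma_pos_of_pos (add_pos hp hq)
  positivity

lemma integral_tsum_rpow {c e : ℕ → ℝ} {s : ℝ} (hs : 0 ≤ s) (he : ∀ k, 0 < e k)
    (hsum : Summable fun k => c k * s ^ e k / e k) :
    ∫ τ in (0 : ℝ)..s, ∑' k, c k * τ ^ (e k - 1) = ∑' k, c k * s ^ e k / e k := by
  have hI (k : ℕ) : ∫ τ in (0 : ℝ)..s, τ ^ (e k - 1) = s ^ e k / e k := by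
    rw [integral_rpow (Or.inl (by linarith [he k])), sub_add_cancel, Real.zero_rpow (he k).ne',
      sub_zero]
  have hint (k : ℕ) : IntegrableOn (fun τ : ℝ => c k * τ ^ (e k - 1)) (Set.Ioc 0 s) :=
    ((intervalIntegrable_iff_integrableOn_Ioc_of_le hs).1
      (intervalIntegral.intervalIntegrable_rpow' (by linarith [he k]))).const_mul _
  have h := hasSum_integral_of_summable_integral_norm hint ?_
  · rw [intervalIntegral.integral_of_le hs, ← h.tsum_eq]
    refine tsum_congr fun k => ?_
    rw [← intervalIntegral.integral_of_le hs, intervalIntegral.integral_const_mul, hI, mul_div_assoc]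
  · refine hsum.norm.congr fun k => ?_
    have : ∫ τ in Set.Ioc 0 s, ‖c k * τ ^ (e k - 1)‖ = ∫ τ in Set.Ioc 0 s, |c k| * τ ^ (e k - 1) := by
      refine setIntegral_congr_fun measurableSet_Ioc fun τ hτ => ?_
      simp [abs_of_nonneg (Real.rpow_nonneg hτ.1.le _)]
    rw [this, ← intervalIntegral.integral_of_le hs, intervalIntegral.integral_const_mul, hI,
      norm_div, norm_mul, Real.norm_eq_abs, Real.norm_eq_abs, Real.norm_eq_abs,
      abs_of_nonneg (Real.rpow_nonneg hs _), abs_of_pos (he k), mul_div_assoc]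

lemma summable_add_index {g : ℕ → ℝ} (hg : Summable fun n : ℕ => ((n : ℝ) + 1) * g n) :
    Summable (fun p : ℕ × ℕ => g (p.1 + p.2)) ∧
      ∑' p : ℕ × ℕ, g (p.1 + p.2) = ∑' n : ℕ, ((n : ℝ) + 1) * g n := by
  let E := Finset.HasAntidiagonal.sigmaAntidiagonalEquivProd (A := ℕ)
  have hE (x : Σ n : ℕ, Finset.HasAntidiagonal.antidiagonal n) : (E x).1 + (E x).2 = x.1 :=
    Finset.HasAntidiagonal.mem_antidiagonal.1 x.2.2
  have hfib (f : ℕ → ℝ) (n : ℕ) :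
      ∑' y : Finset.HasAntidiagonal.antidiagonal n, f ((E ⟨n, y⟩).1 + (E ⟨n, y⟩).2)
        = ((n : ℝ) + 1) * f n := by
    simp [hE, tsum_fintype]
  have hs : Summable (fun x : Σ n : ℕ, Finset.HasAntidiagonal.antidiagonal n =>
      g ((E x).1 + (E x).2)) := by
    refine Summable.of_norm ?_
    refine (summable_sigma_of_nonneg fun _ => norm_nonneg _).2
      ⟨fun n => (hasSum_fintype _).summable, ?_⟩
    refine hg.norm.congr fun n => ?_
    rw [hfib (fun m => ‖g m‖) n, norm_mul, Real.norm_of_nonneg (by positivity)]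
  refine ⟨E.summable_iff.1 hs, ?_⟩
  rw [← E.tsum_eq, hs.tsum_sigma' fun n => (hasSum_fintype _).summable]
  exact tsum_congr fun n => hfib g n

lemma pow_scaled_eq {C1 C2 ρ t : ℝ} (ht : 0 < t) (p : ℝ) (k : ℕ) :
    t ^ p * (-C2 * t ^ ρ / C1) ^ k = (-C2 / C1) ^ k * t ^ ((k : ℝ) * ρ + p) := by
  rw [Real.rpow_add ht, mul_comm (k : ℝ) ρ, Real.rpow_mul ht.le, Real.rpow_natCast, div_pow,
    div_pow, mul_pow]
  ring

lemma rpow_mul_ML_eq {C1 C2 ρ t : ℝ} (ht : 0 < t) (p b : ℝ) :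
    t ^ p / C1 * ML ρ b (-C2 * t ^ ρ / C1)
      = ∑' k : ℕ, (-C2 / C1) ^ k / (C1 * Real.Gamma ((k : ℝ) * ρ + b)) * t ^ ((k : ℝ) * ρ + p) := by
  rw [ML, ← tsum_mul_left]
  refine tsum_congr fun k => ?_
  have h := pow_scaled_eq (C1 := C1) (C2 := C2) (ρ := ρ) ht p k
  calc _ = (t ^ p * (-C2 * t ^ ρ / C1) ^ k) / (C1 * Real.Gamma ((k : ℝ) * ρ + b)) := by
        rw [div_mul_div_comm]
    _ = _ := by rw [h]; ring

lemma summable_rpow_mul_ML {C1 C2 ρ t b : ℝ} (hρ : 0 < ρ) (hb : 0 < b) (ht : 0 < t) (p : ℝ) :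
    Summable fun k : ℕ =>
      (-C2 / C1) ^ k / (C1 * Real.Gamma ((k : ℝ) * ρ + b)) * t ^ ((k : ℝ) * ρ + p) := by
  refine ((summable_ML hρ hb (-C2 * t ^ ρ / C1)).mul_left (t ^ p / C1)).congr fun k => ?_
  have h := pow_scaled_eq (C1 := C1) (C2 := C2) (ρ := ρ) ht p k
  calc _ = (t ^ p * (-C2 * t ^ ρ / C1) ^ k) / (C1 * Real.Gamma ((k : ℝ) * ρ + b)) := by
        rw [div_mul_div_comm]
    _ = _ := by rw [h]; ring

section Renewal

variable {a1 a2 C1 C2 : ℝ}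

lemma continuous_Ufun (h12 : a2 < a1) (h1 : 0 < a1) : Continuous (Ufun a1 a2 C1 C2) := by
  have hρ : 0 < a1 - a2 := sub_pos.2 h12
  have hM := continuous_ML hρ (show 0 < a1 + 1 by linarith)
  have h2 : Continuous fun t : ℝ => t ^ a1 := Real.continuous_rpow_const h1.le
  have h3 : Continuous fun t : ℝ => t ^ (a1 - a2) := Real.continuous_rpow_const hρ.le
  unfold Ufun
  fun_prop

lemma intervalIntegrable_ufun (h12 : a2 < a1) (h1 : 0 < a1) (a b : ℝ) :
    IntervalIntegrable (ufun a1 a2 C1 C2) volume a b := by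
  have hρ : 0 < a1 - a2 := sub_pos.2 h12
  have hM := continuous_ML hρ h1
  have h3 : Continuous fun t : ℝ => t ^ (a1 - a2) := Real.continuous_rpow_const hρ.le
  unfold ufun
  refine IntervalIntegrable.mul_continuousOn ?_ (by fun_prop)
  exact (intervalIntegral.intervalIntegrable_rpow' (by linarith)).div_const _

lemma integral_ufun (h12 : a2 < a1) (h1 : 0 < a1) {t : ℝ} (ht : 0 < t) :
    ∫ τ in (0 : ℝ)..t, ufun a1 a2 C1 C2 τ = Ufun a1 a2 C1 C2 t := by
  have hρ : 0 < a1 - a2 := sub_pos.2 h12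
  have he (k : ℕ) : 0 < (k : ℝ) * (a1 - a2) + a1 := by positivity
  have hterm (k : ℕ) : (-C2 / C1) ^ k / (C1 * Real.Gamma ((k : ℝ) * (a1 - a2) + a1))
      * t ^ ((k : ℝ) * (a1 - a2) + a1) / ((k : ℝ) * (a1 - a2) + a1)
      = (-C2 / C1) ^ k / (C1 * Real.Gamma ((k : ℝ) * (a1 - a2) + (a1 + 1)))
        * t ^ ((k : ℝ) * (a1 - a2) + a1) := by
    rw [← add_assoc, Real.Gamma_add_one (he k).ne']
    field_simp
  have h := integral_tsum_rpow
    (c := fun k : ℕ => (-C2 / C1) ^ k / (C1 * Real.Gamma ((k : ℝ) * (a1 - a2) + a1)))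
    (e := fun k : ℕ => (k : ℝ) * (a1 - a2) + a1) ht.le he
    ((summable_rpow_mul_ML hρ (by linarith) ht a1).congr fun k => (hterm k).symm)
  rw [Ufun, rpow_mul_ML_eq ht, ← tsum_congr hterm, ← h]
  rw [intervalIntegral.integral_of_le ht.le, intervalIntegral.integral_of_le ht.le]
  refine setIntegral_congr_fun measurableSet_Ioc fun τ hτ => ?_
  simp only [ufun]
  rw [rpow_mul_ML_eq hτ.1]
  simp only [add_sub_assoc]

lemma integral_mul_ufun (h12 : a2 < a1) (h1 : 0 < a1) {s : ℝ} (hs : 0 < s) :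
    ∫ τ in (0 : ℝ)..s, τ * ufun a1 a2 C1 C2 τ = s ^ (a1 + 1) / C1 *
      ∑' k : ℕ, ((k : ℝ) * (a1 - a2) + a1) * (-C2 * s ^ (a1 - a2) / C1) ^ k /
        Real.Gamma ((k : ℝ) * (a1 - a2) + a1 + 2) := by
  have hρ : 0 < a1 - a2 := sub_pos.2 h12
  have he' (k : ℕ) : 0 < (k : ℝ) * (a1 - a2) + a1 := by positivity
  have he (k : ℕ) : 0 < (k : ℝ) * (a1 - a2) + (a1 + 1) := by positivity
  have hsum : Summable fun k : ℕ =>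
      (-C2 / C1) ^ k / (C1 * Real.Gamma ((k : ℝ) * (a1 - a2) + a1))
      * s ^ ((k : ℝ) * (a1 - a2) + (a1 + 1)) / ((k : ℝ) * (a1 - a2) + (a1 + 1)) := by
    refine ((summable_rpow_mul_ML (C1 := C1) (C2 := C2) hρ h1 hs (a1 + 1)).norm.of_norm_bounded
      fun k => ?_)
    rw [norm_div]
    refine div_le_self (norm_nonneg _) ?_
    rw [Real.norm_of_nonneg (he k).le]
    have : 0 ≤ (k : ℝ) * (a1 - a2) := by positivity
    linarith
  have h := integral_tsum_rpow
    (c := fun k : ℕ => (-C2 / C1) ^ k / (C1 * Real.Gamma ((k : ℝ) * (a1 - a2) + a1)))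
    (e := fun k : ℕ => (k : ℝ) * (a1 - a2) + (a1 + 1)) hs.le he hsum
  rw [← tsum_mul_left]
  have hterm (k : ℕ) : s ^ (a1 + 1) / C1 * (((k : ℝ) * (a1 - a2) + a1) *
      (-C2 * s ^ (a1 - a2) / C1) ^ k / Real.Gamma ((k : ℝ) * (a1 - a2) + a1 + 2))
      = (-C2 / C1) ^ k / (C1 * Real.Gamma ((k : ℝ) * (a1 - a2) + a1))
      * s ^ ((k : ℝ) * (a1 - a2) + (a1 + 1)) / ((k : ℝ) * (a1 - a2) + (a1 + 1)) := by
    have hp := pow_scaled_eq (C1 := C1) (C2 := C2) (ρ := a1 - a2) hs (a1 + 1) k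
    have hG : Real.Gamma ((k : ℝ) * (a1 - a2) + a1 + 2)
        = ((k : ℝ) * (a1 - a2) + (a1 + 1)) * (((k : ℝ) * (a1 - a2) + a1)
          * Real.Gamma ((k : ℝ) * (a1 - a2) + a1)) := by
      rw [← Real.Gamma_add_one (he' k).ne', add_assoc _ a1 1, ← Real.Gamma_add_one (he k).ne']
      ring_nf
    have hG0 := (Real.Gamma_pos_of_pos (he' k)).ne'
    have h1 := (he k).ne'
    have h2 := (he' k).ne'
    calc _ = (s ^ (a1 + 1) * (-C2 * s ^ (a1 - a2) / C1) ^ k) * ((k : ℝ) * (a1 - a2) + a1) / C1 /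
          Real.Gamma ((k : ℝ) * (a1 - a2) + a1 + 2) := by ring
      _ = _ := by
        rw [hp, hG]
        field_simp
  rw [tsum_congr hterm, ← h, intervalIntegral.integral_of_le hs.le,
    intervalIntegral.integral_of_le hs.le]
  refine setIntegral_congr_fun measurableSet_Ioc fun τ hτ => ?_
  have hmul : τ * ufun a1 a2 C1 C2 τ
      = τ ^ a1 / C1 * ML (a1 - a2) a1 (-C2 * τ ^ (a1 - a2) / C1) := by
    rw [ufun, Real.rpow_sub_one hτ.1.ne']
    field_simp [hτ.1.ne']
  simp only [hmul]
  rw [rpow_mul_ML_eq hτ.1]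
  refine tsum_congr fun k => ?_
  rw [show (k : ℝ) * (a1 - a2) + (a1 + 1) - 1 = (k : ℝ) * (a1 - a2) + a1 by ring]

lemma integral_Ufun_sub_mul_ufun (h12 : a2 < a1) (h1 : 0 < a1) {s : ℝ} (hs : 0 < s) :
    ∫ τ in (0 : ℝ)..s, Ufun a1 a2 C1 C2 (s - τ) * ufun a1 a2 C1 C2 τ
      = s ^ (2 * a1) / C1 ^ 2 * ML2 (a1 - a2) (2 * a1 + 1) (-C2 * s ^ (a1 - a2) / C1) := by
  have hρ : 0 < a1 - a2 := sub_pos.2 h12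
  let p (j : ℕ) : ℝ := (j : ℝ) * (a1 - a2) + (a1 + 1)
  let q (k : ℕ) : ℝ := (k : ℝ) * (a1 - a2) + a1
  have hp (j : ℕ) : 0 < p j := by positivity
  have hq (k : ℕ) : 0 < q k := by positivity
  let c (x : ℕ × ℕ) : ℝ := (-C2 / C1) ^ (x.1 + x.2) /
    (C1 ^ 2 * (Real.Gamma (p x.1) * Real.Gamma (q x.2)))
  let g (n : ℕ) : ℝ := s ^ (2 * a1) / C1 ^ 2 * ((-C2 * s ^ (a1 - a2) / C1) ^ n /
    Real.Gamma ((n : ℝ) * (a1 - a2) + (2 * a1 + 1)))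
  have hbeta (x : ℕ × ℕ) := integral_sub_rpow_mul_rpow (hp x.1) (hq x.2) hs
  have hg : Summable fun n : ℕ => ((n : ℝ) + 1) * g n := by
    refine ((summable_ML2 hρ (show 0 < 2 * a1 + 1 by linarith)
      (-C2 * s ^ (a1 - a2) / C1)).mul_left (s ^ (2 * a1) / C1 ^ 2)).congr fun n => ?_
    simp only [g]
    ring
  have hval (x : ℕ × ℕ) : c x * (Real.Gamma (p x.1) * Real.Gamma (q x.2) /
      Real.Gamma (p x.1 + q x.2) * s ^ (p x.1 + q x.2 - 1)) = g (x.1 + x.2) := by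
    have h := pow_scaled_eq (C1 := C1) (C2 := C2) (ρ := a1 - a2) hs (2 * a1) (x.1 + x.2)
    have hp0 := (Real.Gamma_pos_of_pos (hp x.1)).ne'
    have hq0 := (Real.Gamma_pos_of_pos (hq x.2)).ne'
    have e1 : p x.1 + q x.2 = ((x.1 + x.2 : ℕ) : ℝ) * (a1 - a2) + (2 * a1 + 1) := by
      simp only [p, q]
      push_cast
      ring
    have e2 : ((x.1 + x.2 : ℕ) : ℝ) * (a1 - a2) + (2 * a1 + 1) - 1
        = ((x.1 + x.2 : ℕ) : ℝ) * (a1 - a2) + 2 * a1 := by ring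
    calc _ = (-C2 / C1) ^ (x.1 + x.2) * s ^ (p x.1 + q x.2 - 1) /
          (C1 ^ 2 * Real.Gamma (p x.1 + q x.2)) := by
          simp only [c]
          field_simp
      _ = g (x.1 + x.2) := by
          rw [e1, e2, ← h]
          simp only [g]
          rw [div_mul_div_comm]
  have hgs := summable_add_index hg
  have h := hasSum_integral_of_summable_integral_norm (μ := volume.restrict (Set.Ioc 0 s))
    (F := fun (x : ℕ × ℕ) (τ : ℝ) => c x * ((s - τ) ^ (p x.1 - 1) * τ ^ (q x.2 - 1)))
    (fun x => ((intervalIntegrable_iff_integrableOn_Ioc_of_le hs.le).1 (hbeta x).1).const_mul _) ?_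
  · have h2 := h.tsum_eq
    simp_rw [integral_const_mul, ← intervalIntegral.integral_of_le hs.le, (hbeta _).2, hval] at h2
    rw [hgs.2] at h2
    rw [ML2, ← tsum_mul_left]
    trans ∑' n : ℕ, ((n : ℝ) + 1) * g n
    · rw [h2, intervalIntegral.integral_of_le hs.le, intervalIntegral.integral_of_le hs.le,
        integral_Ioc_eq_integral_Ioo, integral_Ioc_eq_integral_Ioo]
      refine setIntegral_congr_fun measurableSet_Ioo fun τ hτ => ?_
      have hsτ : 0 < s - τ := sub_pos.2 hτ.2
      have hU := summable_rpow_mul_ML (C1 := C1) (C2 := C2) hρ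
        (show 0 < a1 + 1 by linarith) hsτ a1
      have hu := summable_rpow_mul_ML (C1 := C1) (C2 := C2) hρ h1 hτ.1 (a1 - 1)
      simp only [Ufun, ufun]
      rw [rpow_mul_ML_eq hsτ, rpow_mul_ML_eq hτ.1, tsum_mul_tsum_of_summable_norm hU.norm hu.norm]
      refine tsum_congr fun x => ?_
      have e1 : p x.1 - 1 = (x.1 : ℝ) * (a1 - a2) + a1 := by simp only [p]; ring
      have e2 : q x.2 - 1 = (x.2 : ℝ) * (a1 - a2) + (a1 - 1) := by simp only [q]; ring
      rw [e1, e2]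
      simp only [c, p, q, pow_add]
      rw [mul_mul_mul_comm, div_mul_div_comm]
      ring
    · refine tsum_congr fun n => ?_
      simp only [g]
      ring
  · refine hgs.1.norm.congr fun x => ?_
    have hn : ∫ τ in Set.Ioc 0 s, ‖c x * ((s - τ) ^ (p x.1 - 1) * τ ^ (q x.2 - 1))‖
        = ∫ τ in Set.Ioc 0 s, |c x| * ((s - τ) ^ (p x.1 - 1) * τ ^ (q x.2 - 1)) := by
      refine setIntegral_congr_fun measurableSet_Ioc fun τ hτ => ?_
      have hnn : 0 ≤ (s - τ) ^ (p x.1 - 1) * τ ^ (q x.2 - 1) :=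
        mul_nonneg (Real.rpow_nonneg (sub_nonneg.2 hτ.2) _) (Real.rpow_nonneg hτ.1.le _)
      simp only [norm_mul (c x), Real.norm_of_nonneg hnn, Real.norm_eq_abs (c x)]
    rw [hn, integral_const_mul, ← intervalIntegral.integral_of_le hs.le, (hbeta x).2, ← hval x,
      norm_mul, Real.norm_eq_abs (c x), Real.norm_of_nonneg]
    have := Real.Gamma_pos_of_pos (hp x.1)
    have := Real.Gamma_pos_of_pos (hq x.2)
    have := Real.Gamma_pos_of_pos (add_pos (hp x.1) (hq x.2))
    positivity

end Renewal

lemma tendsto_rpow_mul_ufun {a1 a2 C1 C2 : ℝ} (ha2 : 0 < a2) (ha12 : a2 < a1) (ha1 : a1 < 1)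
    (hC1 : 0 < C1) (hC2 : 0 < C2) :
    Tendsto (fun t : ℝ => t ^ (1 - a2) * ufun a1 a2 C1 C2 t) atTop
      (𝓝 (C2 * Real.Gamma a2)⁻¹) := by
  have hρ : 0 < a1 - a2 := sub_pos.2 ha12
  have hx : Tendsto (fun t : ℝ => C2 / C1 * t ^ (a1 - a2)) atTop atTop :=
    (tendsto_rpow_atTop hρ).const_mul_atTop (div_pos hC2 hC1)
  have h := ((tendsto_mul_ML_neg hρ (by linarith) (sub_lt_self a1 ha2)).comp hx).const_mul C2⁻¹
  rw [sub_sub_cancel, ← mul_inv] at h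
  refine h.congr' ?_
  filter_upwards [eventually_gt_atTop 0] with t ht
  have h1 : t ^ (1 - a2) * t ^ (a1 - 1) = t ^ (a1 - a2) := by
    rw [← Real.rpow_add ht]
    ring_nf
  have h2 : -C2 * t ^ (a1 - a2) / C1 = -(C2 / C1 * t ^ (a1 - a2)) := by ring
  simp only [Function.comp, ufun]
  rw [h2, ← h1]
  field_simp

/-- If `t ^ r * u t → c` with `0 ≤ r`, the rescaled translates `t ^ r * u (t - y)` converge to `c`,
boundedly for `y` in a compact interval. -/
lemma tendsto_rpow_mul_translate {u : ℝ → ℝ} {r c s : ℝ} (hr : 0 ≤ r)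
    (hu : Tendsto (fun t : ℝ => t ^ r * u t) atTop (𝓝 c)) :
    (∀ y, Tendsto (fun t : ℝ => t ^ r * u (t - y)) atTop (𝓝 c)) ∧
      ∃ M, 0 ≤ M ∧ ∀ᶠ t in atTop, ∀ y ∈ Set.Icc 0 s, |t ^ r * u (t - y)| ≤ M := by
  constructor
  · intro y
    have hshift : Tendsto (fun t : ℝ => t - y) atTop atTop :=
      tendsto_atTop_add_const_right _ _ tendsto_id
    have hinv : Tendsto (fun t : ℝ => 1 + y * (t - y)⁻¹) atTop (𝓝 1) := by
      simpa using ((tendsto_inv_atTop_zero.comp hshift).const_mul y).const_add 1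
    have hpow := (hinv.rpow_const (p := r) (Or.inl one_ne_zero)).mul (hu.comp hshift)
    rw [Real.one_rpow, one_mul] at hpow
    refine hpow.congr' ?_
    filter_upwards [eventually_gt_atTop (0 : ℝ), eventually_gt_atTop y] with t ht hty
    have hpos : 0 < t - y := sub_pos.2 hty
    have h1 : 1 + y * (t - y)⁻¹ = t / (t - y) := by
      field_simp
      ring
    simp only [Function.comp]
    rw [h1, Real.div_rpow ht.le hpos.le, ← mul_assoc, div_mul_cancel₀ _ (by positivity)]
  · have hb : ∀ᶠ v in atTop, |v ^ r * u v| ≤ |c| + 1 :=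
      (hu.abs.eventually (gt_mem_nhds (lt_add_one |c|))).mono fun _ h => h.le
    obtain ⟨T, hT⟩ := eventually_atTop.1 hb
    refine ⟨2 ^ r * (|c| + 1), by positivity, ?_⟩
    filter_upwards [eventually_ge_atTop (T + s), eventually_ge_atTop (2 * s),
      eventually_gt_atTop 0] with t h1 h2 h3 y hy
    have hv : t / 2 ≤ t - y := by linarith [hy.2]
    have hv0 : 0 < t - y := by linarith
    have h4 := hT (t - y) (by linarith [hy.2])
    have h5 : t ^ r ≤ 2 ^ r * (t - y) ^ r := by
      rw [← Real.mul_rpow (by norm_num) hv0.le]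
      exact Real.rpow_le_rpow h3.le (by linarith) hr
    rw [abs_mul, abs_of_nonneg (Real.rpow_nonneg hv0.le r)] at h4
    rw [abs_mul, abs_of_nonneg (Real.rpow_nonneg h3.le r)]
    calc t ^ r * |u (t - y)| ≤ 2 ^ r * (t - y) ^ r * |u (t - y)| := by gcongr
      _ = 2 ^ r * ((t - y) ^ r * |u (t - y)|) := by ring
      _ ≤ _ := by gcongr

lemma Ufun_sub_Ufun {a1 a2 C1 C2 : ℝ} (h12 : a2 < a1) (h1 : 0 < a1) {t τ : ℝ} (ht : 0 < t)
    (hτ : τ < t) :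
    Ufun a1 a2 C1 C2 (t - τ) - Ufun a1 a2 C1 C2 t
      = -∫ y in (0 : ℝ)..τ, ufun a1 a2 C1 C2 (t - y) := by
  rw [intervalIntegral.integral_comp_sub_left (fun v => ufun a1 a2 C1 C2 v) t, sub_zero,
    ← integral_ufun h12 h1 (sub_pos.2 hτ), ← integral_ufun h12 h1 ht,
    ← intervalIntegral.integral_interval_sub_left (intervalIntegrable_ufun h12 h1 0 t)
      (intervalIntegrable_ufun h12 h1 0 (t - τ))]
  ring

lemma CovY_sub_eq {a1 a2 C1 C2 : ℝ} (h12 : a2 < a1) (h1 : 0 < a1) {s t : ℝ} (hs : 0 < s)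
    (hst : s ≤ t) :
    CovY a1 a2 C1 C2 s t
        - s ^ (2 * a1) / C1 ^ 2 * ML2 (a1 - a2) (2 * a1 + 1) (-C2 * s ^ (a1 - a2) / C1)
      = ∫ τ in (0 : ℝ)..s,
          (Ufun a1 a2 C1 C2 (t - τ) - Ufun a1 a2 C1 C2 t) * ufun a1 a2 C1 C2 τ := by
  have hU := continuous_Ufun (C1 := C1) (C2 := C2) h12 h1
  have hu := intervalIntegrable_ufun (C1 := C1) (C2 := C2) h12 h1 0 s
  have hi (v : ℝ) : IntervalIntegrable
      (fun τ => Ufun a1 a2 C1 C2 (v - τ) * ufun a1 a2 C1 C2 τ) volume 0 s :=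
    hu.continuousOn_mul (by fun_prop)
  simp_rw [CovY, min_eq_left hst, add_mul, sub_mul]
  rw [intervalIntegral.integral_add (hi s) (hi t),
    intervalIntegral.integral_sub (hi t) (hu.const_mul _), intervalIntegral.integral_const_mul,
    integral_Ufun_sub_mul_ufun h12 h1 hs, integral_ufun h12 h1 hs]
  ring

/-- For every fixed `s > 0`, the refined covariance asymptotic
`t^{1-α₂}(Cov_Y(s,t) - (s^{2α₁}/C₁²) E²_{α₁-α₂,2α₁+1}(-C₂ s^{α₁-α₂}/C₁)) → -K(s)`. -/
theorem stmt_11 (a1 a2 C1 C2 : ℝ) (ha2 : 0 < a2) (ha12 : a2 < a1) (ha1 : a1 < 1)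
    (hC1 : 0 < C1) (hC2 : 0 < C2) (hC : C1 + C2 = 1) (s : ℝ) (hs : 0 < s) :
    Tendsto (fun t : ℝ => t ^ (1 - a2) *
        (CovY a1 a2 C1 C2 s t
          - s ^ (2 * a1) / C1 ^ 2
            * ML2 (a1 - a2) (2 * a1 + 1) (-C2 * s ^ (a1 - a2) / C1)))
      atTop (𝓝 (-(Kfun a1 a2 C1 C2 s))) := by
  have h1 : 0 < a1 := ha2.trans ha12
  have hU := continuous_Ufun (C1 := C1) (C2 := C2) ha12 h1
  have hu := intervalIntegrable_ufun (C1 := C1) (C2 := C2) ha12 h1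
  obtain ⟨hlim, M, hM0, hM⟩ := tendsto_rpow_mul_translate (s := s) (by linarith)
    (tendsto_rpow_mul_ufun ha2 ha12 ha1 hC1 hC2)
  have hut (t τ : ℝ) : IntervalIntegrable (fun y => ufun a1 a2 C1 C2 (t - y)) volume 0 τ := by
    simpa using (hu t (t - τ)).comp_sub_left t
  have hinner {τ : ℝ} (hτ : τ ∈ Set.Ioc 0 s) :
      Tendsto (fun t : ℝ => ∫ y in (0 : ℝ)..τ, t ^ (1 - a2) * ufun a1 a2 C1 C2 (t - y)) atTop
        (𝓝 (∫ _ in (0 : ℝ)..τ, (C2 * Real.Gamma a2)⁻¹)) := by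
    refine intervalIntegral.tendsto_integral_filter_of_dominated_convergence (fun _ => M) ?_ ?_
      intervalIntegrable_const (Eventually.of_forall fun y _ => hlim y)
    · exact Eventually.of_forall fun t =>
        (intervalIntegrable_iff.1 ((hut t τ).const_mul _)).aestronglyMeasurable
    · filter_upwards [hM] with t ht
      refine Eventually.of_forall fun y hy => ht y ?_
      rw [Set.uIoc_of_le hτ.1.le] at hy
      exact ⟨hy.1.le, hy.2.trans hτ.2⟩
  have hincr : ∀ᶠ t in atTop, ∀ τ ∈ Set.Ioc 0 s,
      t ^ (1 - a2) * (Ufun a1 a2 C1 C2 (t - τ) - Ufun a1 a2 C1 C2 t)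
        = -∫ y in (0 : ℝ)..τ, t ^ (1 - a2) * ufun a1 a2 C1 C2 (t - y) := by
    filter_upwards [eventually_gt_atTop s] with t ht τ hτ
    rw [Ufun_sub_Ufun ha12 h1 (hs.trans ht) (hτ.2.trans_lt ht),
      intervalIntegral.integral_const_mul]
    ring
  have hmain : Tendsto (fun t : ℝ => ∫ τ in (0 : ℝ)..s, t ^ (1 - a2) *
      (Ufun a1 a2 C1 C2 (t - τ) - Ufun a1 a2 C1 C2 t) * ufun a1 a2 C1 C2 τ) atTop
      (𝓝 (∫ τ in (0 : ℝ)..s, -(C2 * Real.Gamma a2)⁻¹ * (τ * ufun a1 a2 C1 C2 τ))) := by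
    refine intervalIntegral.tendsto_integral_filter_of_dominated_convergence
      (fun τ => M * s * ‖ufun a1 a2 C1 C2 τ‖) ?_ ?_ ((hu 0 s).norm.const_mul _) ?_
    · refine Eventually.of_forall fun t => (intervalIntegrable_iff.1 ?_).aestronglyMeasurable
      exact (hu 0 s).continuousOn_mul (by fun_prop)
    · filter_upwards [hM, hincr] with t ht hi
      refine Eventually.of_forall fun τ hτ => ?_
      rw [Set.uIoc_of_le hs.le] at hτ
      rw [norm_mul, hi τ hτ, norm_neg]
      gcongr
      refine (intervalIntegral.norm_integral_le_of_norm_le_const (C := M) fun y hy => ?_).trans ?_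
      · rw [Set.uIoc_of_le hτ.1.le] at hy
        exact ht y ⟨hy.1.le, hy.2.trans hτ.2⟩
      · rw [sub_zero, abs_of_pos hτ.1]
        exact mul_le_mul_of_nonneg_left hτ.2 hM0
    · refine Eventually.of_forall fun τ hτ => ?_
      rw [Set.uIoc_of_le hs.le] at hτ
      have h := ((hinner hτ).neg).mul_const (ufun a1 a2 C1 C2 τ)
      rw [intervalIntegral.integral_const, sub_zero, smul_eq_mul] at h
      rw [show -(C2 * Real.Gamma a2)⁻¹ * (τ * ufun a1 a2 C1 C2 τ)
        = -(τ * (C2 * Real.Gamma a2)⁻¹) * ufun a1 a2 C1 C2 τ by ring]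
      refine h.congr' ?_
      filter_upwards [hincr] with t ht
      rw [ht τ hτ]
  have hK : ∫ τ in (0 : ℝ)..s, -(C2 * Real.Gamma a2)⁻¹ * (τ * ufun a1 a2 C1 C2 τ)
      = -(Kfun a1 a2 C1 C2 s) := by
    rw [intervalIntegral.integral_const_mul, integral_mul_ufun ha12 h1 hs, Kfun, ← mul_assoc,
      ← neg_mul]
    congr 1
    rw [div_eq_mul_inv, div_eq_mul_inv, mul_inv, mul_inv, mul_inv]
    ring
  rw [← hK]
  refine hmain.congr' ?_
  filter_upwards [eventually_ge_atTop s] with t ht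
  rw [CovY_sub_eq ha12 h1 hs ht, ← intervalIntegral.integral_const_mul]
  simp only [mul_assoc]
end

section
/- For every fixed δ > 0, the integral I(t, t+δ) = ∫₀^t U(t+δ−τ) u(τ) dτ satisfies lim_{t→∞} I(t, t+δ) / ( ((t+δ)^{α₁+α₂}/(C₁ C₂)) E_{α₁−α₂, α₁+α₂+1}(−C₂ (t+δ)^{α₁−α₂}/C₁) ) = 1. -/
open Real MeasureTheory Filter Topology

lemma Gamma_ge_exp_mul_rpow {M y : ℝ} (hM : 0 < M) (hy : 1 ≤ y) :
    rexp (-(M + 1)) * M ^ (y - 1) ≤ Real.Gamma y := by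
  rw [Real.Gamma_eq_integral (by linarith)]
  have hint := Real.GammaIntegral_convergent (s := y) (by linarith)
  calc rexp (-(M + 1)) * M ^ (y - 1)
      = ∫ _x in Set.Ioc M (M + 1), rexp (-(M + 1)) * M ^ (y - 1) := by simp
    _ ≤ ∫ x in Set.Ioc M (M + 1), rexp (-x) * x ^ (y - 1) := by
        refine setIntegral_mono_on (integrableOn_const (by simp)) (hint.mono_set fun x hx => hM.trans hx.1)
          measurableSet_Ioc fun x hx => ?_
        have h1 : rexp (-(M + 1)) ≤ rexp (-x) := Real.exp_le_exp.2 (by linarith [hx.2])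
        have h2 : M ^ (y - 1) ≤ x ^ (y - 1) :=
          Real.rpow_le_rpow hM.le hx.1.le (by linarith)
        exact mul_le_mul h1 h2 (by positivity) (by positivity)
    _ ≤ ∫ x in Set.Ioi 0, rexp (-x) * x ^ (y - 1) := by
        refine setIntegral_mono_set hint ?_ ?_
        · filter_upwards [ae_restrict_mem measurableSet_Ioi] with x hx
          have : (0 : ℝ) < x := hx
          positivity
        · exact (show Set.Ioc M (M + 1) ⊆ Set.Ioi 0 from fun x hx => hM.trans hx.1).eventuallyLE

lemma Gamma_mul_add_pos {a b : ℝ} (ha : 0 < a) (hb : 0 < b) (k : ℕ) :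
    0 < Real.Gamma ((k : ℝ) * a + b) :=
  Real.Gamma_pos_of_pos (by positivity)

lemma summable_ML_of_nonneg {a b x : ℝ} (ha : 0 < a) (hb : 0 < b) (hx : 0 ≤ x) :
    Summable fun k : ℕ => x ^ k / Real.Gamma ((k : ℝ) * a + b) := by
  set M : ℝ := (2 * x + 1) ^ a⁻¹ with hM_def
  have hM : 0 < M := by positivity
  have hMa : M ^ a = 2 * x + 1 := by
    rw [hM_def, ← Real.rpow_mul (by positivity), inv_mul_cancel₀ ha.ne', Real.rpow_one]
  have hq0 : 0 ≤ x / (2 * x + 1) := by positivity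
  have hq1 : x / (2 * x + 1) < 1 := by rw [div_lt_one (by positivity)]; linarith
  have hgeo := (summable_geometric_of_lt_one hq0 hq1).mul_left (rexp (M + 1) * M ^ (1 - b))
  refine hgeo.of_norm_bounded_eventually_nat ?_
  filter_upwards [eventually_ge_atTop ⌈a⁻¹⌉₊] with k hk
  have hk' : a⁻¹ ≤ k := (Nat.le_ceil _).trans (by exact_mod_cast hk)
  have hk1 : 1 ≤ (k : ℝ) * a := by
    calc (1 : ℝ) = a⁻¹ * a := (inv_mul_cancel₀ ha.ne').symm
      _ ≤ k * a := by gcongr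
  have hG := Gamma_ge_exp_mul_rpow hM (y := (k : ℝ) * a + b) (by linarith)
  have hGpos := Gamma_mul_add_pos ha hb k
  rw [Real.norm_of_nonneg (by positivity), div_le_iff₀ hGpos]
  have hpow : M ^ ((k : ℝ) * a + b - 1) = (2 * x + 1) ^ k * M ^ (b - 1) := by
    rw [← hMa, ← Real.rpow_natCast, ← Real.rpow_mul hM.le, ← Real.rpow_add hM]
    ring_nf
  have hinv : M ^ (1 - b) * M ^ (b - 1) = 1 := by
    rw [← Real.rpow_add hM]; simp
  have hexp : rexp (M + 1) * rexp (-(M + 1)) = 1 := by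
    rw [← Real.exp_add]; simp
  calc x ^ k = rexp (M + 1) * M ^ (1 - b) * (x / (2 * x + 1)) ^ k *
        (rexp (-(M + 1)) * M ^ ((k : ℝ) * a + b - 1)) := by
        rw [hpow, div_pow]
        have : (2 * x + 1) ^ k ≠ 0 := by positivity
        field_simp
        linear_combination (-x ^ k * rexp (M + 1) * rexp (-(M + 1))) * hinv - x ^ k * hexp
    _ ≤ _ := by gcongr

lemma differentiable_ML {a b : ℝ} (ha : 0 < a) (hb : 0 < b) : Differentiable ℝ (ML a b) := by
  set p := FormalMultilinearSeries.ofScalars ℝ (fun k : ℕ => (Real.Gamma ((k : ℝ) * a + b))⁻¹)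
  have hr : p.radius = ⊤ := by
    refine p.radius_eq_top_of_summable_norm fun r => ?_
    convert summable_ML_of_nonneg ha hb r.2 using 2 with k
    rw [FormalMultilinearSeries.ofScalars_norm, norm_inv,
      Real.norm_of_nonneg (Gamma_mul_add_pos ha hb k).le, div_eq_inv_mul]
    rfl
  have hsum : p.sum = ML a b := by
    funext x
    refine (FormalMultilinearSeries.ofScalars_sum_eq _ x).trans ?_
    simp [ML, div_eq_inv_mul]
  have hp := p.hasFPowerSeriesOnBall (by rw [hr]; simp)
  rw [hr, hsum] at hp
  intro x
  exact (hp.differentiableOn.differentiableAt (Metric.isOpen_eball.mem_nhds (by simp)))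

lemma ML_zero {a b : ℝ} : ML a b 0 = (Real.Gamma b)⁻¹ := by
  rw [ML, tsum_eq_single 0 (by intro k hk; simp [hk])]
  simp

lemma ML_recurrence {a b : ℝ} (ha : 0 < a) (hb : 0 < b) (x : ℝ) :
    ML a b x = (Real.Gamma b)⁻¹ + x * ML a (a + b) x := by
  rw [ML, (summable_ML ha hb x).tsum_eq_zero_add, ML, ← tsum_mul_left]
  congr 1
  · simp
  · refine tsum_congr fun k => ?_
    push_cast
    rw [show ((k : ℝ) + 1) * a + b = k * a + (a + b) by ring]
    ring

lemma integral_rpow_mul_rpow {p q t : ℝ} (hp : 0 < p) (hq : 0 < q) (ht : 0 < t) :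
    ∫ x in (0 : ℝ)..t, x ^ (p - 1) * (t - x) ^ (q - 1) =
      t ^ (p + q - 1) * (Real.Gamma p * Real.Gamma q / Real.Gamma (p + q)) := by
  have h := Complex.betaIntegral_scaled p q ht
  have hG : Complex.betaIntegral p q =
      ((Real.Gamma p * Real.Gamma q / Real.Gamma (p + q) : ℝ) : ℂ) := by
    have := Complex.Gamma_mul_Gamma_eq_betaIntegral (s := (p : ℂ)) (t := (q : ℂ))
      (by simpa using hp) (by simpa using hq)
    have hne : (Real.Gamma (p + q) : ℂ) ≠ 0 := by
      exact_mod_cast (Real.Gamma_pos_of_pos (by positivity)).ne'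
    rw [← Complex.ofReal_add, Complex.Gamma_ofReal, Complex.Gamma_ofReal,
      Complex.Gamma_ofReal] at this
    push_cast
    rw [eq_div_iff hne, this]
    ring
  rw [hG] at h
  have hl : ∫ x in (0 : ℝ)..t, (x : ℂ) ^ ((p : ℂ) - 1) * ((t : ℂ) - x) ^ ((q : ℂ) - 1) =
      ((∫ x in (0 : ℝ)..t, x ^ (p - 1) * (t - x) ^ (q - 1) : ℝ) : ℂ) := by
    rw [← intervalIntegral.integral_ofReal]
    refine intervalIntegral.integral_congr fun x hx => ?_
    rw [Set.uIcc_of_le ht.le] at hx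
    rw [Complex.ofReal_mul, Complex.ofReal_cpow hx.1, Complex.ofReal_cpow (by linarith [hx.2])]
    push_cast
    rfl
  rw [hl] at h
  have : ((t : ℂ) ^ ((p : ℂ) + q - 1)) = ((t ^ (p + q - 1) : ℝ) : ℂ) := by
    rw [Complex.ofReal_cpow ht.le]
    push_cast
    rfl
  rw [this] at h
  exact_mod_cast h

lemma intervalIntegrable_rpow_mul_rpow {p q t : ℝ} (hp : 0 < p) (hq : 0 < q) (ht : 0 < t) :
    IntervalIntegrable (fun x : ℝ => x ^ (p - 1) * (t - x) ^ (q - 1)) volume 0 t := by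
  by_contra hcon
  have h := integral_rpow_mul_rpow hp hq ht
  rw [intervalIntegral.integral_undef hcon] at h
  have := Real.Gamma_pos_of_pos hp
  have := Real.Gamma_pos_of_pos hq
  have := Real.Gamma_pos_of_pos (add_pos hp hq)
  exact absurd h (by positivity)

/-- The function `t ^ (b - 1) * E_{a,b}(-c t ^ a)`, whose Laplace transform is
`s ^ (a - b) / (s ^ a + c)`. -/
noncomputable def mlPow (a c b t : ℝ) : ℝ :=
  t ^ (b - 1) * ML a b (-(c * t ^ a))

lemma mlPow_eq_tsum {a c b t : ℝ} (ht : 0 < t) :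
    mlPow a c b t =
      ∑' k : ℕ, (-c) ^ k / Real.Gamma ((k : ℝ) * a + b) * t ^ ((k : ℝ) * a + b - 1) := by
  rw [mlPow, ML, ← tsum_mul_left]
  refine tsum_congr fun k => ?_
  rw [show (k : ℝ) * a + b - 1 = (b - 1) + a * k by ring, Real.rpow_add ht, Real.rpow_mul ht.le,
    Real.rpow_natCast, show -(c * t ^ a) = (-c) * t ^ a by ring, mul_pow]
  ring

lemma continuousOn_ML_comp {a c b t : ℝ} (ha : 0 < a) (hb : 0 < b) :
    ContinuousOn (fun s : ℝ => ML a b (-(c * s ^ a))) (Set.Icc 0 t) := by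
  refine (differentiable_ML ha hb).continuous.comp_continuousOn ?_
  exact ((Real.continuous_rpow_const ha.le).const_mul c).neg.continuousOn

lemma differentiableAt_mlPow {a c b t : ℝ} (ha : 0 < a) (hb : 0 < b) (ht : 0 < t) :
    DifferentiableAt ℝ (mlPow a c b) t := by
  have h1 : DifferentiableAt ℝ (fun s : ℝ => s ^ (b - 1)) t :=
    Real.differentiableAt_rpow_const_of_ne _ ht.ne'
  have h2 : DifferentiableAt ℝ (fun s : ℝ => -(c * s ^ a)) t :=
    ((Real.differentiableAt_rpow_const_of_ne _ ht.ne').const_mul c).neg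
  exact h1.mul ((differentiable_ML ha hb _).comp t h2)

lemma continuousOn_mlPow {a c b : ℝ} (ha : 0 < a) (hb : 0 < b) :
    ContinuousOn (mlPow a c b) (Set.Ioi 0) := fun _ ht =>
  (differentiableAt_mlPow ha hb ht).continuousAt.continuousWithinAt

lemma intervalIntegrable_mlPow_conv {a c b β t : ℝ} (ha : 0 < a) (hb : 0 < b) (hβ : 0 < β)
    (ht : 0 < t) :
    IntervalIntegrable (fun s => (t - s) ^ (β - 1) * mlPow a c b s) volume 0 t := by
  have h := (intervalIntegrable_rpow_mul_rpow hb hβ ht).mul_continuousOn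
    (g := fun s : ℝ => ML a b (-(c * s ^ a)))
    (by rw [Set.uIcc_of_le ht.le]; exact continuousOn_ML_comp ha hb)
  refine h.congr fun s _ => ?_
  simp only [mlPow]
  ring

lemma integral_mlPow_conv {a c b β t : ℝ} (ha : 0 < a) (hb : 0 < b) (hβ : 0 < β)
    (ht : 0 < t) :
    ∫ s in (0 : ℝ)..t, (t - s) ^ (β - 1) * mlPow a c b s =
      Real.Gamma β * mlPow a c (b + β) t := by
  set F : ℕ → ℝ → ℝ := fun k s => (-c) ^ k / Real.Gamma ((k : ℝ) * a + b) *
    (s ^ ((k : ℝ) * a + b - 1) * (t - s) ^ (β - 1)) with hF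
  have hbk (k : ℕ) : 0 < (k : ℝ) * a + b := by positivity
  have hint (k : ℕ) : Integrable (F k) (volume.restrict (Set.Ioc 0 t)) :=
    ((intervalIntegrable_iff_integrableOn_Ioc_of_le ht.le).1
      (intervalIntegrable_rpow_mul_rpow (hbk k) hβ ht)).const_mul _
  have hval (k : ℕ) : ∫ s in Set.Ioc 0 t, s ^ ((k : ℝ) * a + b - 1) * (t - s) ^ (β - 1) =
      t ^ ((k : ℝ) * a + b + β - 1) *
        (Real.Gamma ((k : ℝ) * a + b) * Real.Gamma β / Real.Gamma ((k : ℝ) * a + b + β)) := by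
    rw [← intervalIntegral.integral_of_le ht.le, integral_rpow_mul_rpow (hbk k) hβ ht]
  have hterm (d : ℝ) (k : ℕ) : d ^ k / Real.Gamma ((k : ℝ) * a + b) *
      (t ^ ((k : ℝ) * a + b + β - 1) *
        (Real.Gamma ((k : ℝ) * a + b) * Real.Gamma β / Real.Gamma ((k : ℝ) * a + b + β))) =
      Real.Gamma β * (d ^ k / Real.Gamma ((k : ℝ) * a + (b + β)) *
        t ^ ((k : ℝ) * a + (b + β) - 1)) := by
    have := (Gamma_mul_add_pos ha hb k).ne'
    rw [← add_assoc]
    field_simp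
  have hnorm (k : ℕ) : ∫ s in Set.Ioc 0 t, ‖F k s‖ =
      Real.Gamma β * t ^ (b + β - 1) *
        ((|c| * t ^ a) ^ k / Real.Gamma ((k : ℝ) * a + (b + β))) := by
    have : ∀ s ∈ Set.Ioc 0 t, ‖F k s‖ = |c| ^ k / Real.Gamma ((k : ℝ) * a + b) *
        (s ^ ((k : ℝ) * a + b - 1) * (t - s) ^ (β - 1)) := by
      intro s hs
      have h1 : 0 ≤ s ^ ((k : ℝ) * a + b - 1) * (t - s) ^ (β - 1) :=
        mul_nonneg (Real.rpow_nonneg hs.1.le _) (Real.rpow_nonneg (by linarith [hs.2]) _)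
      rw [hF]
      simp only
      rw [norm_mul, Real.norm_of_nonneg h1, norm_div, norm_pow, norm_neg, Real.norm_eq_abs,
        Real.norm_of_nonneg (Gamma_mul_add_pos ha hb k).le]
    rw [setIntegral_congr_fun measurableSet_Ioc this, integral_const_mul, hval, hterm,
      show (k : ℝ) * a + (b + β) - 1 = (b + β - 1) + a * k by ring, Real.rpow_add ht,
      Real.rpow_mul ht.le, Real.rpow_natCast, mul_pow]
    ring
  have hsum : Summable fun k => ∫ s in Set.Ioc 0 t, ‖F k s‖ := by
    simp_rw [hnorm]
    exact (summable_ML ha (by positivity) _).mul_left _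
  have key := integral_tsum_of_summable_integral_norm hint hsum
  rw [mlPow_eq_tsum ht, ← tsum_mul_left, intervalIntegral.integral_of_le ht.le]
  calc ∫ s in Set.Ioc 0 t, (t - s) ^ (β - 1) * mlPow a c b s
      = ∫ s in Set.Ioc 0 t, ∑' k, F k s := by
        refine setIntegral_congr_fun measurableSet_Ioc fun s hs => ?_
        rw [mlPow_eq_tsum hs.1, ← tsum_mul_left]
        refine tsum_congr fun k => ?_
        rw [hF]
        ring
    _ = ∑' k, ∫ s in Set.Ioc 0 t, F k s := key.symm
    _ = _ := by
        refine tsum_congr fun k => ?_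
        rw [hF, integral_const_mul, hval, hterm]

lemma intervalIntegrable_mlPow {a c b t : ℝ} (ha : 0 < a) (hb : 0 < b) (ht : 0 < t) :
    IntervalIntegrable (mlPow a c b) volume 0 t := by
  simpa using intervalIntegrable_mlPow_conv (c := c) ha hb one_pos ht

lemma integral_mlPow {a c b t : ℝ} (ha : 0 < a) (hb : 0 < b) (ht : 0 < t) :
    ∫ s in (0 : ℝ)..t, mlPow a c b s = mlPow a c (b + 1) t := by
  simpa using integral_mlPow_conv (c := c) ha hb one_pos ht

lemma mlPow_recurrence {a c b t : ℝ} (ha : 0 < a) (hb : 0 < b) (ht : 0 < t) :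
    mlPow a c b t = t ^ (b - 1) / Real.Gamma b - c * mlPow a c (b + a) t := by
  rw [mlPow, ML_recurrence ha hb, mlPow, show b + a - 1 = (b - 1) + a by ring,
    Real.rpow_add ht, add_comm b a]
  ring

lemma mlPow_pos_of_near_zero {a c b : ℝ} (ha : 0 < a) (hb : 0 < b) :
    ∃ η > 0, ∀ t, 0 < t → t ≤ η → 0 < mlPow a c b t := by
  have hcont : ContinuousAt (fun s : ℝ => ML a b (-(c * s ^ a))) 0 := by
    refine (differentiable_ML ha hb).continuous.continuousAt.comp ?_
    exact ((Real.continuous_rpow_const ha.le).const_mul c).neg.continuousAt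
  have h0 : 0 < ML a b (-(c * (0 : ℝ) ^ a)) := by
    rw [Real.zero_rpow ha.ne', mul_zero, neg_zero, ML_zero]
    exact inv_pos.2 (Real.Gamma_pos_of_pos hb)
  obtain ⟨ε, hε, h⟩ := Metric.eventually_nhds_iff.1 (hcont.eventually (lt_mem_nhds h0))
  refine ⟨ε / 2, half_pos hε, fun t ht htε => mul_pos (Real.rpow_pos_of_pos ht _) (h ?_)⟩
  rw [Real.dist_eq, sub_zero, abs_of_pos ht]
  linarith

lemma integral_mlPow_self_conv {a c t : ℝ} (ha : 0 < a) (ha1 : a < 1) (ht : 0 < t) :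
    ∫ s in (0 : ℝ)..t, (t - s) ^ (-a) * mlPow a c a s = Real.Gamma (1 - a) * mlPow a c 1 t := by
  have h := integral_mlPow_conv (c := c) (β := 1 - a) ha ha (by linarith) ht
  rwa [show 1 - a - 1 = -a by ring, show a + (1 - a) = 1 by ring] at h

lemma mlPow_one_eq {a c t : ℝ} (ha : 0 < a) (ht : 0 < t) :
    mlPow a c 1 t = 1 - c * ∫ s in (0 : ℝ)..t, mlPow a c a s := by
  rw [integral_mlPow ha ha ht, mlPow_recurrence ha one_pos ht, add_comm a 1]
  simp

lemma rpow_neg_tangent_le {a x y : ℝ} (ha : 0 < a) (hx : 0 < x) (hy : 0 < y) :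
    y ^ (-a) + a * (y - x) * y ^ (-a - 1) ≤ x ^ (-a) := by
  have hxy : 0 < x / y := div_pos hx hy
  have h1 : 1 + a * (1 - x / y) ≤ (x / y) ^ (-a) := by
    rw [Real.rpow_def_of_pos hxy]
    have h2 := Real.log_le_sub_one_of_pos hxy
    have h3 := Real.add_one_le_exp (Real.log (x / y) * -a)
    nlinarith
  have h4 : x ^ (-a) = y ^ (-a) * (x / y) ^ (-a) := by
    rw [Real.div_rpow hx.le hy.le, mul_div_cancel₀ _ (Real.rpow_pos_of_pos hy _).ne']
  rw [h4, Real.rpow_sub_one hy.ne']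
  calc y ^ (-a) + a * (y - x) * (y ^ (-a) / y) = y ^ (-a) * (1 + a * (1 - x / y)) := by
        field_simp
    _ ≤ _ := by gcongr

/-- A maximum principle: the right end point of an interval on which `mlPow a c a` is positive
cannot be a zero, since a fractional derivative would be negative there. -/
lemma mlPow_self_pos_of_pos_left {a c T : ℝ} (ha : 0 < a) (ha1 : a < 1) (hc : 0 < c)
    (hT : 0 < T) (hpos : ∀ s, 0 < s → s < T → 0 < mlPow a c a s) : 0 < mlPow a c a T := by
  by_contra! hle
  set g := mlPow a c a with hg
  have hΓ : 0 < Real.Gamma (1 - a) := Real.Gamma_pos_of_pos (by linarith)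
  have hgint : IntervalIntegrable g volume 0 T := intervalIntegrable_mlPow ha ha hT
  have hkint (t : ℝ) (ht : 0 < t) :
      IntervalIntegrable (fun s => (t - s) ^ (-a) * g s) volume 0 t := by
    have := intervalIntegrable_mlPow_conv (c := c) (β := 1 - a) ha ha (by linarith) ht
    rwa [show 1 - a - 1 = -a by ring] at this
  obtain ⟨L, hL, hLg⟩ :=
    (differentiableAt_mlPow (c := c) ha ha hT).isBigO_sub.exists_pos
  obtain ⟨ε, hε, hLε⟩ := Metric.eventually_nhds_iff.1 hLg.bound
  set G := ∫ s in (0 : ℝ)..(T / 2), g s with hG_def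
  have hG : 0 < G := by
    refine intervalIntegral.intervalIntegral_pos_of_pos_on
      (intervalIntegrable_mlPow ha ha (half_pos hT)) (fun s hs => hpos s hs.1 ?_) (half_pos hT)
    linarith [hs.2]
  set κ := a * T ^ (-a - 1) * G with hκ_def
  have hκ : 0 < κ := by positivity
  have hmain (h : ℝ) (hh : 0 < h) (hhε : h < ε) (hhT : h < T / 2) :
      κ ≤ L * h ^ (1 - a) / (1 - a) + c * Real.Gamma (1 - a) * L * h := by
    set t := T - h with ht_def
    have ht : 0 < t := by linarith
    have htT : t < T := by linarith
    have hTt : T / 2 < t := by linarith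
    have hgL : ∀ s ∈ Set.Icc t T, g s ≤ L * h := by
      intro s hs
      have h1 := hLε (y := s) (by
        rw [Real.dist_eq, abs_lt]; constructor <;> linarith [hs.1, hs.2])
      rw [Real.norm_eq_abs, Real.norm_eq_abs] at h1
      have h2 : |s - T| ≤ h := by rw [abs_le]; constructor <;> linarith [hs.1, hs.2]
      have h3 := le_abs_self (g s - g T)
      have h4 : L * |s - T| ≤ L * h := by gcongr
      linarith
    have hsub1 : Set.uIcc 0 t ⊆ Set.uIcc 0 T := by
      rw [Set.uIcc_of_le ht.le, Set.uIcc_of_le hT.le]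
      exact Set.Icc_subset_Icc_right htT.le
    have hsub2 : Set.uIcc t T ⊆ Set.uIcc 0 T := by
      rw [Set.uIcc_of_le htT.le, Set.uIcc_of_le hT.le]
      exact Set.Icc_subset_Icc_left ht.le
    have hsub3 : Set.uIcc 0 (T / 2) ⊆ Set.uIcc 0 t := by
      rw [Set.uIcc_of_le ht.le, Set.uIcc_of_le (half_pos hT).le]
      exact Set.Icc_subset_Icc_right hTt.le
    have hsub4 : Set.uIcc (T / 2) t ⊆ Set.uIcc 0 t := by
      rw [Set.uIcc_of_le ht.le, Set.uIcc_of_le hTt.le]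
      exact Set.Icc_subset_Icc_left (half_pos hT).le
    have hdiff : (∫ s in (0 : ℝ)..T, (T - s) ^ (-a) * g s) -
        ∫ s in (0 : ℝ)..t, (t - s) ^ (-a) * g s =
        -(c * Real.Gamma (1 - a) * ∫ s in t..T, g s) := by
      rw [integral_mlPow_self_conv ha ha1 hT, integral_mlPow_self_conv ha ha1 ht,
        mlPow_one_eq ha hT, mlPow_one_eq ha ht,
        ← intervalIntegral.integral_add_adjacent_intervals (hgint.mono_set hsub1)
          (hgint.mono_set hsub2)]
      ring
    have hgend : ∫ s in t..T, g s ≤ L * h * h := by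
      calc ∫ s in t..T, g s ≤ ∫ _s in t..T, L * h :=
            intervalIntegral.integral_mono_on htT.le (hgint.mono_set hsub2) (by simp) hgL
        _ = L * h * h := by simp [ht_def]; ring
    have hker : ∫ s in t..T, (T - s) ^ (-a) = h ^ (1 - a) / (1 - a) := by
      rw [intervalIntegral.integral_comp_sub_left (fun x : ℝ => x ^ (-a)) T,
        integral_rpow (Or.inl (by linarith)), sub_self, ht_def, sub_sub_cancel,
        show -a + 1 = 1 - a by ring, Real.zero_rpow (by linarith), sub_zero]
    have hkerint : IntervalIntegrable (fun s => (T - s) ^ (-a)) volume t T := by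
      have := (intervalIntegral.intervalIntegrable_rpow' (a := T - t) (b := T - T) (r := -a)
        (by linarith)).comp_sub_left T
      simpa using this
    have hend : ∫ s in t..T, (T - s) ^ (-a) * g s ≤ L * h * (h ^ (1 - a) / (1 - a)) := by
      rw [← hker, mul_comm (L * h), ← intervalIntegral.integral_mul_const]
      refine intervalIntegral.integral_mono_on htT.le ((hkint T hT).mono_set hsub2)
        (hkerint.mul_const _) fun s hs => ?_
      exact mul_le_mul_of_nonneg_left (hgL s hs) (Real.rpow_nonneg (by linarith [hs.2]) _)
    have hDint : IntervalIntegrable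
        (fun s => (t - s) ^ (-a) * g s - (T - s) ^ (-a) * g s) volume 0 t :=
      (hkint t ht).sub ((hkint T hT).mono_set hsub1)
    have hpt (s : ℝ) (hs : 0 < s) (hst : s < t) :
        a * h * T ^ (-a - 1) * g s ≤ (t - s) ^ (-a) * g s - (T - s) ^ (-a) * g s := by
      have h1 := rpow_neg_tangent_le ha (sub_pos.2 hst) (sub_pos.2 (hst.trans htT))
      have h2 : T ^ (-a - 1) ≤ (T - s) ^ (-a - 1) :=
        Real.rpow_le_rpow_of_nonpos (by linarith) (by linarith) (by linarith)
      rw [show T - s - (t - s) = h by rw [ht_def]; ring] at h1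
      have h3 : a * h * T ^ (-a - 1) ≤ a * h * (T - s) ^ (-a - 1) := by gcongr
      rw [← sub_mul]
      exact mul_le_mul_of_nonneg_right (by linarith) (hpos s hs (hst.trans htT)).le
    have hD : a * h * T ^ (-a - 1) * G ≤
        ∫ s in (0 : ℝ)..t, ((t - s) ^ (-a) * g s - (T - s) ^ (-a) * g s) := by
      rw [← intervalIntegral.integral_add_adjacent_intervals (hDint.mono_set hsub3)
        (hDint.mono_set hsub4)]
      have h1 : a * h * T ^ (-a - 1) * G ≤
          ∫ s in (0 : ℝ)..(T / 2), ((t - s) ^ (-a) * g s - (T - s) ^ (-a) * g s) := by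
        rw [hG_def, ← intervalIntegral.integral_const_mul]
        refine intervalIntegral.integral_mono_on_of_le_Ioo (half_pos hT).le
          ((hgint.mono_set (hsub3.trans hsub1)).const_mul _) (hDint.mono_set hsub3) fun s hs => ?_
        exact hpt s hs.1 (hs.2.trans hTt)
      have h2 : ∫ _s in (T / 2)..t, (0 : ℝ) ≤
          ∫ s in (T / 2)..t, ((t - s) ^ (-a) * g s - (T - s) ^ (-a) * g s) := by
        refine intervalIntegral.integral_mono_on_of_le_Ioo hTt.le (by simp)
          (hDint.mono_set hsub4) fun s hs => ?_
        have hs0 : 0 < s := (half_pos hT).trans hs.1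
        refine le_trans ?_ (hpt s hs0 hs.2)
        have := hpos s hs0 (hs.2.trans htT)
        positivity
      rw [intervalIntegral.integral_zero] at h2
      linarith
    rw [intervalIntegral.integral_sub (hkint t ht) ((hkint T hT).mono_set hsub1)] at hD
    rw [← intervalIntegral.integral_add_adjacent_intervals ((hkint T hT).mono_set hsub1)
      ((hkint T hT).mono_set hsub2)] at hdiff
    have hgend' := mul_le_mul_of_nonneg_left hgend (mul_pos hc hΓ).le
    refine le_of_mul_le_mul_left ?_ hh
    calc h * κ = a * h * T ^ (-a - 1) * G := by rw [hκ_def]; ring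
      _ ≤ L * h * (h ^ (1 - a) / (1 - a)) + c * Real.Gamma (1 - a) * (L * h * h) := by linarith
      _ = _ := by ring
  have hlim : Tendsto (fun h : ℝ => L * h ^ (1 - a) / (1 - a) + c * Real.Gamma (1 - a) * L * h)
      (𝓝[>] 0) (𝓝 0) := by
    have hcont : Continuous
        (fun h : ℝ => L * h ^ (1 - a) / (1 - a) + c * Real.Gamma (1 - a) * L * h) := by
      have := Real.continuous_rpow_const (q := 1 - a) (by linarith)
      fun_prop
    have := hcont.tendsto 0
    rw [Real.zero_rpow (by linarith)] at this
    simp only [mul_zero, zero_div, add_zero] at this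
    exact this.mono_left nhdsWithin_le_nhds
  refine absurd (ge_of_tendsto hlim ?_) (not_le.2 hκ)
  filter_upwards [Ioo_mem_nhdsGT (lt_min hε (half_pos hT))] with h hh
  exact hmain h hh.1 (hh.2.trans_le (min_le_left _ _)) (hh.2.trans_le (min_le_right _ _))

lemma mlPow_self_pos {a c t : ℝ} (ha : 0 < a) (ha1 : a < 1) (hc : 0 < c) (ht : 0 < t) :
    0 < mlPow a c a t := by
  by_contra! hle
  obtain ⟨η, hη, hpos⟩ := mlPow_pos_of_near_zero (c := c) ha ha
  set S := Set.Icc η t ∩ mlPow a c a ⁻¹' Set.Iic 0 with hS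
  have hcont : ContinuousOn (mlPow a c a) (Set.Icc η t) :=
    (continuousOn_mlPow ha ha).mono fun s hs => hη.trans_le hs.1
  have hclosed : IsClosed S := hcont.preimage_isClosed_of_isClosed isClosed_Icc isClosed_Iic
  have htη : η ≤ t := by
    by_contra! h
    exact absurd (hpos t ht h.le) (not_lt.2 hle)
  have hne : S.Nonempty := ⟨t, ⟨htη, le_rfl⟩, hle⟩
  have hbdd : BddBelow S := ⟨η, fun s hs => hs.1.1⟩
  have hmem := hclosed.csInf_mem hne hbdd
  refine absurd (mlPow_self_pos_of_pos_left ha ha1 hc (hη.trans_le hmem.1.1) fun s hs hlt => ?_)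
    (not_lt.2 hmem.2)
  by_contra! hcon
  have hsη : η ≤ s := by
    by_contra! h
    exact absurd (hpos s hs h.le) (not_lt.2 hcon)
  exact absurd (csInf_le hbdd ⟨⟨hsη, hlt.le.trans hmem.1.2⟩, hcon⟩) (not_le.2 hlt)

lemma mlPow_nonneg {a c b t : ℝ} (ha : 0 < a) (ha1 : a < 1) (hc : 0 < c) (hb : a < b)
    (ht : 0 < t) : 0 ≤ mlPow a c b t := by
  have h := integral_mlPow_conv (c := c) (β := b - a) ha ha (by linarith) ht
  rw [add_sub_cancel] at h
  have h0 : 0 ≤ ∫ s in (0 : ℝ)..t, (t - s) ^ (b - a - 1) * mlPow a c a s := by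
    have := intervalIntegral.integral_mono_on_of_le_Ioo ht.le
      (f := fun _ => (0 : ℝ)) (by simp)
      (intervalIntegrable_mlPow_conv (c := c) (β := b - a) ha ha (by linarith) ht)
      fun s hs => mul_nonneg (Real.rpow_nonneg (by linarith [hs.2]) _)
        (mlPow_self_pos ha ha1 hc hs.1).le
    simpa using this
  rw [h] at h0
  exact nonneg_of_mul_nonneg_right h0 (Real.Gamma_pos_of_pos (by linarith))

lemma mlPow_one_le {a c s t : ℝ} (ha : 0 < a) (ha1 : a < 1) (hc : 0 < c) (hs : 0 < s)
    (hst : s < t) : mlPow a c 1 t ≤ mlPow a c 1 s := by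
  have ht := hs.trans hst
  have h1 := intervalIntegrable_mlPow (c := c) ha ha ht
  have h2 : IntervalIntegrable (mlPow a c a) volume s t := h1.mono_set (by
    rw [Set.uIcc_of_le hst.le, Set.uIcc_of_le ht.le]
    exact Set.Icc_subset_Icc_left hs.le)
  rw [mlPow_one_eq ha hs, mlPow_one_eq ha ht,
    ← intervalIntegral.integral_add_adjacent_intervals (intervalIntegrable_mlPow ha ha hs) h2]
  have : 0 ≤ ∫ x in s..t, mlPow a c a x := intervalIntegral.integral_nonneg hst.le
    fun x hx => (mlPow_self_pos ha ha1 hc (hs.trans_le hx.1)).le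
  have := mul_nonneg hc.le this
  linarith

lemma mlPow_one_le_inv {a c t : ℝ} (ha : 0 < a) (ha1 : a < 1) (hc : 0 < c) (ht : 0 < t) :
    mlPow a c 1 t ≤ (1 + c / (a * Real.Gamma a) * t ^ a)⁻¹ := by
  have hΓ := Real.Gamma_pos_of_pos ha
  have h := integral_mlPow_conv (c := c) (β := a) ha one_pos ha ht
  have hker : ∫ s in (0 : ℝ)..t, (t - s) ^ (a - 1) = t ^ a / a := by
    rw [intervalIntegral.integral_comp_sub_left (fun x : ℝ => x ^ (a - 1)) t,
      integral_rpow (Or.inl (by linarith)), sub_self, sub_zero, sub_add_cancel,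
      Real.zero_rpow ha.ne', sub_zero]
  have hkerint : IntervalIntegrable (fun s => (t - s) ^ (a - 1)) volume 0 t := by
    have := (intervalIntegral.intervalIntegrable_rpow' (a := t - 0) (b := t - t) (r := a - 1)
      (by linarith)).comp_sub_left t
    simpa using this
  have hle : t ^ a / a * mlPow a c 1 t ≤ Real.Gamma a * mlPow a c (1 + a) t := by
    rw [← h, ← hker, ← intervalIntegral.integral_mul_const]
    refine intervalIntegral.integral_mono_on_of_le_Ioo ht.le (hkerint.mul_const _)
      (intervalIntegrable_mlPow_conv ha one_pos ha ht) fun s hs => ?_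
    exact mul_le_mul_of_nonneg_left (mlPow_one_le ha ha1 hc hs.1 hs.2)
      (Real.rpow_nonneg (by linarith [hs.2]) _)
  have hrec := mlPow_recurrence (c := c) ha one_pos ht
  simp only [sub_self, Real.rpow_zero, Real.Gamma_one, div_one] at hrec
  rw [← one_div, le_div_iff₀ (by positivity)]
  have h2 : c / (a * Real.Gamma a) * t ^ a * mlPow a c 1 t ≤ c * mlPow a c (1 + a) t := by
    calc c / (a * Real.Gamma a) * t ^ a * mlPow a c 1 t
        = c / Real.Gamma a * (t ^ a / a * mlPow a c 1 t) := by field_simp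
      _ ≤ c / Real.Gamma a * (Real.Gamma a * mlPow a c (1 + a) t) := by gcongr
      _ = _ := by field_simp
  linarith

lemma tendsto_mlPow_one {a c : ℝ} (ha : 0 < a) (ha1 : a < 1) (hc : 0 < c) :
    Tendsto (mlPow a c 1) atTop (𝓝 0) := by
  have hΓ := Real.Gamma_pos_of_pos ha
  have hlim : Tendsto (fun t : ℝ => (1 + c / (a * Real.Gamma a) * t ^ a)⁻¹) atTop (𝓝 0) :=
    tendsto_inv_atTop_zero.comp (tendsto_atTop_add_const_left _ _
      ((tendsto_rpow_atTop ha).const_mul_atTop (by positivity)))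
  refine tendsto_of_tendsto_of_tendsto_of_le_of_le' tendsto_const_nhds hlim ?_ ?_
  · filter_upwards [eventually_gt_atTop 0] with t ht using mlPow_nonneg ha ha1 hc ha1 ht
  · filter_upwards [eventually_gt_atTop 0] with t ht using mlPow_one_le_inv ha ha1 hc ht

lemma tendsto_integral_mlPow_self {a c : ℝ} (ha : 0 < a) (ha1 : a < 1) (hc : 0 < c) :
    Tendsto (fun t => ∫ s in (0 : ℝ)..t, mlPow a c a s) atTop (𝓝 c⁻¹) := by
  have h := ((tendsto_mlPow_one ha ha1 hc).const_sub 1).div_const c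
  rw [sub_zero, one_div] at h
  refine h.congr' ?_
  filter_upwards [eventually_gt_atTop 0] with t ht
  rw [mlPow_one_eq ha ht]
  field_simp
  ring

lemma integrableOn_mlPow_self {a c : ℝ} (ha : 0 < a) (ha1 : a < 1) (hc : 0 < c) :
    IntegrableOn (mlPow a c a) (Set.Ioi 0) := by
  refine integrableOn_Ioi_of_intervalIntegral_norm_tendsto c⁻¹ 0 (l := atTop)
    (b := fun n : ℕ => (n : ℝ) + 1) (fun n => ?_)
    (tendsto_atTop_add_const_right _ _ tendsto_natCast_atTop_atTop) ?_
  · have hn : (0 : ℝ) < (n : ℝ) + 1 := by positivity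
    exact (intervalIntegrable_iff_integrableOn_Ioc_of_le hn.le).1
      (intervalIntegrable_mlPow ha ha hn)
  · refine ((tendsto_integral_mlPow_self ha ha1 hc).comp
      (tendsto_atTop_add_const_right _ 1 tendsto_natCast_atTop_atTop)).congr fun n => ?_
    have hn : (0 : ℝ) ≤ (n : ℝ) + 1 := by positivity
    rw [Function.comp_apply, intervalIntegral.integral_of_le hn,
      intervalIntegral.integral_of_le hn]
    refine setIntegral_congr_fun measurableSet_Ioc fun s hs => ?_
    exact (Real.norm_of_nonneg (mlPow_self_pos ha ha1 hc hs.1).le).symm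

lemma integral_Ioi_mlPow_self {a c : ℝ} (ha : 0 < a) (ha1 : a < 1) (hc : 0 < c) :
    ∫ s in Set.Ioi 0, mlPow a c a s = c⁻¹ :=
  tendsto_nhds_unique (intervalIntegral_tendsto_integral_Ioi 0
    (integrableOn_mlPow_self ha ha1 hc) tendsto_id) (tendsto_integral_mlPow_self ha ha1 hc)

/-- The asymptotics `E_{a,b}(-c t ^ a) ∼ t ^ (-a) / (c Γ(b - a))` for `b ≥ a + 1`. -/
lemma tendsto_mlPow_div {a c b : ℝ} (ha : 0 < a) (ha1 : a < 1) (hc : 0 < c) (hb : a + 1 ≤ b) :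
    Tendsto (fun t => mlPow a c b t / t ^ (b - a - 1)) atTop
      (𝓝 ((c * Real.Gamma (b - a))⁻¹)) := by
  have hβ : 0 < b - a := by linarith
  have hΓ := Real.Gamma_pos_of_pos hβ
  set F : ℝ → ℝ → ℝ := fun t =>
    (Set.Ioc 0 t).indicator fun s => (1 - s / t) ^ (b - a - 1) * mlPow a c a s with hF
  have hFint {t : ℝ} (ht : 0 < t) :
      ∫ s in Set.Ioi 0, F t s = Real.Gamma (b - a) * (mlPow a c b t / t ^ (b - a - 1)) := by
    have h := integral_mlPow_conv (c := c) (β := b - a) ha ha hβ ht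
    rw [add_sub_cancel] at h
    rw [hF, setIntegral_indicator measurableSet_Ioc,
      Set.inter_eq_self_of_subset_right (fun s hs => hs.1), mul_div_assoc', ← h,
      intervalIntegral.integral_of_le ht.le, ← integral_div]
    refine setIntegral_congr_fun measurableSet_Ioc fun s hs => ?_
    have : 1 - s / t = (t - s) / t := by field_simp
    rw [this, Real.div_rpow (by linarith [hs.2]) ht.le]
    ring
  have hlim : Tendsto (fun t => ∫ s in Set.Ioi 0, F t s) atTop
      (𝓝 (∫ s in Set.Ioi 0, mlPow a c a s)) := by
    refine tendsto_integral_filter_of_dominated_convergence (mlPow a c a) ?_ ?_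
      (integrableOn_mlPow_self ha ha1 hc) ?_
    · filter_upwards [eventually_gt_atTop 0] with t ht
      refine AEStronglyMeasurable.indicator ?_ measurableSet_Ioc
      refine AEStronglyMeasurable.mul ?_ (integrableOn_mlPow_self ha ha1 hc).1
      exact (by fun_prop : Measurable fun s : ℝ => (1 - s / t) ^ (b - a - 1)).aestronglyMeasurable
    · filter_upwards [eventually_gt_atTop 0] with t ht
      filter_upwards [ae_restrict_mem measurableSet_Ioi] with s hs
      have hg := (mlPow_self_pos ha ha1 hc hs).le
      by_cases hst : s ∈ Set.Ioc 0 t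
      · have h0 : 0 ≤ 1 - s / t := by
          rw [sub_nonneg, div_le_one ht]; exact hst.2
        have h1 : 1 - s / t ≤ 1 := by
          have := div_nonneg hst.1.le ht.le
          linarith
        rw [hF]
        simp only
        rw [Set.indicator_of_mem hst, norm_mul, Real.norm_of_nonneg hg,
          Real.norm_of_nonneg (Real.rpow_nonneg h0 _)]
        exact mul_le_of_le_one_left hg (Real.rpow_le_one h0 h1 (by linarith))
      · rw [hF]
        simp only
        rw [Set.indicator_of_notMem hst, norm_zero]
        exact hg
    · filter_upwards [ae_restrict_mem measurableSet_Ioi] with s hs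
      have h1 : Tendsto (fun t : ℝ => (1 - s / t) ^ (b - a - 1)) atTop (𝓝 1) := by
        have h2 : Tendsto (fun t : ℝ => 1 - s / t) atTop (𝓝 1) := by
          simpa using (tendsto_const_nhds (x := s)).div_atTop tendsto_id |>.const_sub 1
        simpa using h2.rpow_const (p := b - a - 1) (Or.inl one_ne_zero)
      have h3 := h1.mul_const (mlPow a c a s)
      rw [one_mul] at h3
      refine h3.congr' ?_
      filter_upwards [eventually_ge_atTop s] with t hst
      exact (Set.indicator_of_mem (s := Set.Ioc 0 t) ⟨hs, hst⟩
        fun s => (1 - s / t) ^ (b - a - 1) * mlPow a c a s).symm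
  rw [integral_Ioi_mlPow_self ha ha1 hc] at hlim
  have h := hlim.const_mul (Real.Gamma (b - a))⁻¹
  rw [← mul_inv, mul_comm _ c] at h
  refine h.congr' ?_
  filter_upwards [eventually_gt_atTop 0] with t ht
  rw [hFint ht]
  field_simp

lemma Ufun_eq_mlPow (a1 a2 C1 C2 t : ℝ) :
    Ufun a1 a2 C1 C2 t = mlPow (a1 - a2) (C2 / C1) (a1 + 1) t / C1 := by
  rw [Ufun, mlPow, add_sub_cancel_right]
  ring_nf

lemma ufun_eq_mlPow (a1 a2 C1 C2 t : ℝ) :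
    ufun a1 a2 C1 C2 t = mlPow (a1 - a2) (C2 / C1) a1 t / C1 := by
  rw [ufun, mlPow]
  ring_nf

lemma exists_abs_mlPow_sub_le {a c b ε : ℝ} (ha : 0 < a) (ha1 : a < 1) (hc : 0 < c)
    (hb : a + 1 ≤ b) (hε : 0 < ε) :
    ∃ M, 0 ≤ M ∧ ∀ x, 0 < x →
      |mlPow a c b x - (c * Real.Gamma (b - a))⁻¹ * x ^ (b - a - 1)| ≤
        ε * x ^ (b - a - 1) + M := by
  have hev := (Metric.tendsto_nhds.1 (tendsto_mlPow_div ha ha1 hc hb) ε hε)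
  obtain ⟨X, hX⟩ := eventually_atTop.1 hev
  have hcont : ContinuousOn
      (fun x => mlPow a c b x - (c * Real.Gamma (b - a))⁻¹ * x ^ (b - a - 1)) (Set.Icc 0 X) := by
    refine ContinuousOn.sub (ContinuousOn.mul ?_ (continuousOn_ML_comp ha (by linarith)))
      (ContinuousOn.mul continuousOn_const ?_)
    · exact (Real.continuous_rpow_const (by linarith)).continuousOn
    · exact (Real.continuous_rpow_const (by linarith)).continuousOn
  obtain ⟨M, hM⟩ := isCompact_Icc.exists_bound_of_continuousOn hcont
  refine ⟨max M 0, le_max_right _ _, fun x hx => ?_⟩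
  have hxp : 0 < x ^ (b - a - 1) := Real.rpow_pos_of_pos hx _
  rcases le_total x X with h | h
  · have h1 := hM x ⟨hx.le, h⟩
    rw [Real.norm_eq_abs] at h1
    have h2 := le_max_left M 0
    have h3 := mul_pos hε hxp
    linarith
  · have h1 := hX x h
    rw [Real.dist_eq] at h1
    have h2 : mlPow a c b x - (c * Real.Gamma (b - a))⁻¹ * x ^ (b - a - 1) =
        (mlPow a c b x / x ^ (b - a - 1) - (c * Real.Gamma (b - a))⁻¹) * x ^ (b - a - 1) := by
      rw [sub_mul, div_mul_cancel₀ _ hxp.ne']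
    rw [h2, abs_mul, abs_of_pos hxp]
    have h3 := mul_le_mul_of_nonneg_right h1.le hxp.le
    have h4 := le_max_right M 0
    linarith

/-- In a shifted convolution of `mlPow a c (a + p + 1)` with `mlPow a c (a + p)`, the first factor
can be replaced by its asymptotic power `x ^ p / (c Γ(p + 1))`. -/
lemma isLittleO_shifted_conv {a c p δ : ℝ} (ha : 0 < a) (ha1 : a < 1) (hc : 0 < c) (hp : 0 < p)
    (hp1 : p ≤ 1) (hδ : 0 < δ) :
    (fun t => (∫ s in (0 : ℝ)..t, mlPow a c (a + p + 1) (t + δ - s) * mlPow a c (a + p) s) -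
        c⁻¹ * mlPow a c (a + 2 * p + 1) t) =o[atTop] fun t : ℝ => t ^ (2 * p) := by
  have hap : 0 < a + p := by positivity
  set V := mlPow a c (a + p + 1) with hV
  set v := mlPow a c (a + p) with hv
  have hΓ : 0 < Real.Gamma (p + 1) := Real.Gamma_pos_of_pos (by positivity)
  set K := (c * Real.Gamma (p + 1))⁻¹ with hK_def
  have hK : 0 < K := by positivity
  have hexp : a + p + 1 - a = p + 1 := by ring
  have hVlim : Tendsto (fun t => V t / t ^ p) atTop (𝓝 K) := by
    have := tendsto_mlPow_div (b := a + p + 1) ha ha1 hc (by linarith)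
    rwa [hexp, add_sub_cancel_right] at this
  rw [Asymptotics.isLittleO_iff]
  intro ε hε
  set ε' := ε / (2 * (K + 1)) with hε'_def
  have hε' : 0 < ε' := by positivity
  obtain ⟨M, hM0, hM⟩ := exists_abs_mlPow_sub_le (b := a + p + 1) ha ha1 hc (by linarith) hε'
  rw [hexp, add_sub_cancel_right] at hM
  set M' := ε' * δ ^ p + M + K * δ ^ p with hM'_def
  have hlarge : ∀ᶠ t : ℝ in atTop, M' ≤ ε' * t ^ p :=
    ((tendsto_rpow_atTop hp).const_mul_atTop hε').eventually_ge_atTop M'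
  filter_upwards [eventually_gt_atTop 0, hlarge, hVlim.eventually_le_const (lt_add_one K)]
    with t ht htM htV
  have htp : 0 < t ^ p := Real.rpow_pos_of_pos ht _
  rw [div_le_iff₀ htp] at htV
  have hvint : IntervalIntegrable v volume 0 t := intervalIntegrable_mlPow ha hap ht
  have hv0 : ∀ s, 0 < s → 0 ≤ v s := fun s hs => mlPow_nonneg ha ha1 hc (by linarith) hs
  have hVint : ∫ s in (0 : ℝ)..t, v s = V t := integral_mlPow ha hap ht
  have hVcont : ContinuousOn (fun s => V (t + δ - s)) (Set.uIcc 0 t) := by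
    refine (continuousOn_mlPow ha (by linarith)).comp (by fun_prop) fun s hs => ?_
    rw [Set.uIcc_of_le ht.le] at hs
    exact Set.mem_Ioi.2 (by linarith [hs.2])
  have hint1 : IntervalIntegrable (fun s => V (t + δ - s) * v s) volume 0 t :=
    hvint.continuousOn_mul hVcont
  have hint2 : IntervalIntegrable (fun s => K * ((t - s) ^ p * v s)) volume 0 t := by
    have := intervalIntegrable_mlPow_conv (c := c) (β := p + 1) ha hap (by linarith) ht
    rw [add_sub_cancel_right] at this
    exact this.const_mul K
  have hmain : c⁻¹ * mlPow a c (a + 2 * p + 1) t = ∫ s in (0 : ℝ)..t, K * ((t - s) ^ p * v s) := by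
    have := integral_mlPow_conv (c := c) (β := p + 1) ha hap (by linarith) ht
    rw [add_sub_cancel_right] at this
    rw [intervalIntegral.integral_const_mul, this, hK_def,
      show a + p + (p + 1) = a + 2 * p + 1 by ring]
    field_simp
  have hpt : ∀ s ∈ Set.Ioc 0 t, ‖V (t + δ - s) * v s - K * ((t - s) ^ p * v s)‖ ≤
      (ε' * t ^ p + M') * v s := by
    intro s hs
    have hts : 0 ≤ t - s := by linarith [hs.2]
    have h1 := hM (t + δ - s) (by linarith)
    have hsub : (t + δ - s) ^ p ≤ (t - s) ^ p + δ ^ p := by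
      rw [show t + δ - s = (t - s) + δ by ring]
      exact Real.rpow_add_le_add_rpow hts hδ.le hp.le hp1
    have hmono : (t - s) ^ p ≤ (t + δ - s) ^ p :=
      Real.rpow_le_rpow hts (by linarith) hp.le
    have hmono2 : (t - s) ^ p ≤ t ^ p := Real.rpow_le_rpow hts (by linarith [hs.1]) hp.le
    have h2 : |K * (t + δ - s) ^ p - K * (t - s) ^ p| ≤ K * δ ^ p := by
      rw [← mul_sub, abs_mul, abs_of_pos hK, abs_of_nonneg (by linarith)]
      gcongr
      linarith
    have h3 : ε' * (t + δ - s) ^ p ≤ ε' * (t ^ p + δ ^ p) := by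
      gcongr
      linarith
    have h4 := abs_sub_le (V (t + δ - s)) (K * (t + δ - s) ^ p) (K * (t - s) ^ p)
    rw [← mul_assoc, ← sub_mul, norm_mul, Real.norm_of_nonneg (hv0 s hs.1), Real.norm_eq_abs]
    refine mul_le_mul_of_nonneg_right ?_ (hv0 s hs.1)
    rw [hM'_def]
    linarith
  have hbound := intervalIntegral.norm_integral_le_of_norm_le ht.le
    (ae_of_all _ hpt) (hvint.const_mul (ε' * t ^ p + M'))
  rw [intervalIntegral.integral_const_mul, hVint] at hbound
  rw [hmain, ← intervalIntegral.integral_sub hint1 hint2, two_mul p, Real.rpow_add ht,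
    Real.norm_of_nonneg (by positivity : 0 ≤ t ^ p * t ^ p)]
  refine hbound.trans ?_
  calc (ε' * t ^ p + M') * V t ≤ (ε' * t ^ p + ε' * t ^ p) * ((K + 1) * t ^ p) := by
        have : 0 ≤ V t := mlPow_nonneg ha ha1 hc (by linarith) ht
        gcongr
    _ = ε * (t ^ p * t ^ p) := by
        rw [hε'_def]
        field_simp
        ring

/-- For every fixed `δ > 0`,
`I(t,t+δ) ∼ ((t+δ)^{α₁+α₂}/(C₁C₂)) E_{α₁-α₂,α₁+α₂+1}(-C₂(t+δ)^{α₁-α₂}/C₁)` as `t → ∞`. -/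
theorem stmt_13 (a1 a2 C1 C2 : ℝ) (ha2 : 0 < a2) (ha12 : a2 < a1) (ha1 : a1 < 1)
    (hC1 : 0 < C1) (hC2 : 0 < C2) (hC : C1 + C2 = 1) (δ : ℝ) (hδ : 0 < δ) :
    Tendsto (fun t : ℝ =>
        Ifun a1 a2 C1 C2 t (t + δ)
          / ((t + δ) ^ (a1 + a2) / (C1 * C2)
              * ML (a1 - a2) (a1 + a2 + 1) (-C2 * (t + δ) ^ (a1 - a2) / C1)))
      atTop (𝓝 1) := by
  set a := a1 - a2 with ha_def
  set c := C2 / C1 with hc_def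
  have ha : 0 < a := by linarith
  have ha' : a < 1 := by linarith
  have hc : 0 < c := by positivity
  have hΓ : 0 < Real.Gamma (2 * a2 + 1) := Real.Gamma_pos_of_pos (by positivity)
  set W := mlPow a c (a1 + a2 + 1) with hW
  set K := (c * Real.Gamma (2 * a2 + 1))⁻¹ with hK_def
  have hK : 0 < K := by positivity
  have hWlim : Tendsto (fun t => W t / t ^ (2 * a2)) atTop (𝓝 K) := by
    have := tendsto_mlPow_div (b := a1 + a2 + 1) ha ha' hc (by linarith)
    rwa [show a1 + a2 + 1 - a = 2 * a2 + 1 by rw [ha_def]; ring, add_sub_cancel_right] at this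
  have hlittle := isLittleO_shifted_conv (p := a2) ha ha' hc ha2 (by linarith) hδ
  rw [show a + a2 = a1 by rw [ha_def]; ring,
    show a + 2 * a2 + 1 = a1 + a2 + 1 by rw [ha_def]; ring] at hlittle
  have hIlim : Tendsto (fun t => Ifun a1 a2 C1 C2 t (t + δ) / t ^ (2 * a2)) atTop
      (𝓝 (K / (C1 * C2))) := by
    have h := (hlittle.tendsto_div_nhds_zero.add (hWlim.const_mul c⁻¹)).div_const (C1 * C1)
    rw [zero_add, show c⁻¹ * K / (C1 * C1) = K / (C1 * C2) by rw [hc_def]; field_simp] at h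
    refine h.congr fun t => ?_
    have hI : Ifun a1 a2 C1 C2 t (t + δ) =
        (∫ s in (0 : ℝ)..t, mlPow a c (a1 + 1) (t + δ - s) * mlPow a c a1 s) / (C1 * C1) := by
      rw [Ifun, ← intervalIntegral.integral_div]
      refine intervalIntegral.integral_congr fun s _ => ?_
      simp only [Ufun_eq_mlPow, ufun_eq_mlPow]
      rw [div_mul_div_comm]
    rw [hI]
    ring
  have hratio : Tendsto (fun t : ℝ => ((t + δ) / t) ^ (2 * a2)) atTop (𝓝 1) := by
    have h1 : Tendsto (fun t : ℝ => 1 + δ / t) atTop (𝓝 1) := by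
      simpa using ((tendsto_const_nhds (x := δ)).div_atTop tendsto_id).const_add 1
    have h2 := h1.rpow_const (p := 2 * a2) (Or.inl one_ne_zero)
    rw [Real.one_rpow] at h2
    refine h2.congr' ?_
    filter_upwards [eventually_gt_atTop 0] with t ht
    rw [add_div, div_self ht.ne']
  have hDlim : Tendsto (fun t : ℝ => W (t + δ) / (C1 * C2) / t ^ (2 * a2)) atTop
      (𝓝 (K / (C1 * C2))) := by
    have h := ((hWlim.comp (tendsto_atTop_add_const_right _ δ tendsto_id)).mul hratio).div_const
      (C1 * C2)
    rw [mul_one] at h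
    refine h.congr' ?_
    filter_upwards [eventually_gt_atTop 0] with t ht
    have h1 : (t + δ) ^ (2 * a2) ≠ 0 := (Real.rpow_pos_of_pos (by linarith) _).ne'
    simp only [Function.comp_apply, id_eq]
    rw [Real.div_rpow (by linarith) ht.le]
    field_simp
  have hne : K / (C1 * C2) ≠ 0 := by positivity
  have hfinal := hIlim.div hDlim hne
  rw [div_self hne] at hfinal
  refine hfinal.congr' ?_
  filter_upwards [eventually_gt_atTop 0] with t ht
  have htp : t ^ (2 * a2) ≠ 0 := (Real.rpow_pos_of_pos ht _).ne'
  have hden : W (t + δ) / (C1 * C2) = (t + δ) ^ (a1 + a2) / (C1 * C2) *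
      ML a (a1 + a2 + 1) (-C2 * (t + δ) ^ a / C1) := by
    rw [hW, mlPow, add_sub_cancel_right, hc_def,
      show -(C2 / C1 * (t + δ) ^ a) = -C2 * (t + δ) ^ a / C1 by ring]
    ring
  rw [Pi.div_apply, div_div_div_cancel_right₀ htp, hden]
end
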